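/- arXiv:2505.12922 — 2 statements merged into one kernel-verified Lean document; each statement's English description precedes it below -/
import Mathlib

section
/- Let φ ∈ Aut(F) be a 1-involution with a canonical basis {x} ⊔ Y ⊔ U such that φx = x⁻¹, φy = x y x⁻¹ for all y ∈ Y, and φu = u for all u ∈ U, where |Y| < |U| = κ. If σ ∈ Aut(F) commutes with φ, then σx = v x^ε v⁻¹ for some v in the subgroup ⟨U⟩ generated by U (the fixed-point subgroup of φ) and some ε = ±1; moreover, if Y is nonempty, then for every y ∈ Y the element σy lies in a conjugate of the subgroup ⟨Y⟩ generated by Y. -/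
open Pointwise

/-- A subset `S` of a free group is a basis if the canonical homomorphism
`FreeGroup S →* FreeGroup X` extending the inclusion is bijective. -/
def FreeGroup.IsBasis {X : Type*} (S : Set (FreeGroup X)) : Prop :=
  Function.Bijective (FreeGroup.lift (fun s : S => (s : FreeGroup X)))

/-- The subgroup of inner automorphisms of a group `G`, as a subgroup of `MulAut G`. -/
def Inn (G : Type*) [Group G] : Subgroup (MulAut G) :=
  (MulAut.conj : G →* MulAut G).range

instance Inn.normal (G : Type*) [Group G] : (Inn G).Normal := by
  constructor
  rintro - ⟨g, rfl⟩ σ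
  refine ⟨σ g, ?_⟩
  ext x
  simp [MulAut.conj, MulAut.mul_apply, mul_assoc]

/-- The outer automorphism group `Out G = Aut G / Inn G`. -/
abbrev OutAut (G : Type*) [Group G] := MulAut G ⧸ Inn G

/-- The natural homomorphism `Aut G → Out G`. -/
def toOut {G : Type*} [Group G] : MulAut G →* OutAut G :=
  QuotientGroup.mk' (Inn G)

/-- `g` is an involution of the group `G`. -/
def IsInvolution {G : Type*} [Group G] (g : G) : Prop :=
  g ≠ 1 ∧ g ^ 2 = 1

/-- A subset of a group is anti-commutative if its elements pairwise do not commute. -/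
def AntiCommSet {G : Type*} [Group G] (s : Set G) : Prop :=
  ∀ a ∈ s, ∀ b ∈ s, a ≠ b → a * b ≠ b * a

/-- A decomposition `U ⊔ S ⊔ ⊔_{x ∈ S} Y x` of a basis of a free group. -/
structure IsBasisDecomposition {X : Type*} (U S : Set (FreeGroup X))
    (Y : FreeGroup X → Set (FreeGroup X)) : Prop where
  isBasis : FreeGroup.IsBasis (U ∪ S ∪ ⋃ x ∈ S, Y x)
  disjUS : Disjoint U S
  disjUY : ∀ x ∈ S, Disjoint U (Y x)
  disjSY : ∀ x ∈ S, Disjoint S (Y x)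
  disjYY : ∀ x ∈ S, ∀ x' ∈ S, x ≠ x' → Disjoint (Y x) (Y x')

/-- `U ⊔ S ⊔ ⊔_{x ∈ S} Y x` is a canonical basis for the (soft) involution `φ`:
`φ` fixes `U` pointwise, inverts the elements of `S` and conjugates the elements of
`Y x` by `x`. -/
def IsCanonicalBasis {X : Type*} (φ : MulAut (FreeGroup X)) (U S : Set (FreeGroup X))
    (Y : FreeGroup X → Set (FreeGroup X)) : Prop :=
  IsBasisDecomposition U S Y ∧
    (∀ u ∈ U, φ u = u) ∧ (∀ x ∈ S, φ x = x⁻¹) ∧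
    (∀ x ∈ S, ∀ y ∈ Y x, φ y = x * y * x⁻¹)

/-- A soft involution of `Aut F`: an involution admitting a canonical basis. -/
def IsSoftInvolution {X : Type*} (φ : MulAut (FreeGroup X)) : Prop :=
  IsInvolution φ ∧ ∃ U S Y, IsCanonicalBasis φ U S Y

/-- A soft involution of `Out F`: an involution induced by a soft involution of `Aut F`. -/
def IsSoftOutInvolution {X : Type*} (f : OutAut (FreeGroup X)) : Prop :=
  IsInvolution f ∧ ∃ φ, IsSoftInvolution φ ∧ toOut φ = f

/-- A `1`-involution of `Aut F`: a soft involution whose canonical bases have exactly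
one block. -/
def IsOneInvolution {X : Type*} (ψ : MulAut (FreeGroup X)) : Prop :=
  IsInvolution ψ ∧ ∃ (U Y : Set (FreeGroup X)) (x : FreeGroup X),
    IsCanonicalBasis ψ U {x} (fun _ => Y)

/-- A `1`-involution of `Out F`: an involution induced by a `1`-involution of `Aut F`. -/
def IsOneOutInvolution {X : Type*} (f : OutAut (FreeGroup X)) : Prop :=
  IsInvolution f ∧ ∃ ψ, IsOneInvolution ψ ∧ toOut ψ = f

/-- An extremal involution of `Aut F`: an involution inverting one element of a suitable
basis and fixing all other elements of that basis. -/
def IsExtremalInvolution {X : Type*} (φ : MulAut (FreeGroup X)) : Prop :=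
  IsInvolution φ ∧ ∃ (B : Set (FreeGroup X)) (x : FreeGroup X),
    FreeGroup.IsBasis B ∧ x ∈ B ∧ φ x = x⁻¹ ∧ ∀ b ∈ B, b ≠ x → φ b = b

/-- An extremal involution of `Out F`: an involution induced by an extremal involution
of `Aut F`. -/
def IsExtremalOutInvolution {X : Type*} (f : OutAut (FreeGroup X)) : Prop :=
  IsInvolution f ∧ ∃ φ, IsExtremalInvolution φ ∧ toOut φ = f

/-- A symmetry of `Aut F`: an involution inverting all elements of some basis. -/
def IsSymmetryAut {X : Type*} (θ : MulAut (FreeGroup X)) : Prop :=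
  IsInvolution θ ∧ ∃ B : Set (FreeGroup X), FreeGroup.IsBasis B ∧ ∀ b ∈ B, θ b = b⁻¹

/-- A symmetry of `Out F`: an involution whose full preimage in `Aut F` contains a
symmetry. -/
def IsSymmetryOut {X : Type*} (f : OutAut (FreeGroup X)) : Prop :=
  IsInvolution f ∧ ∃ θ, IsSymmetryAut θ ∧ toOut θ = f

/-- Condition (★): the product set `K·K` contains exactly one conjugacy class of
involutions, and no element of `K` is a square. -/
def StarCondition {G : Type*} [Group G] (K : Set G) : Prop :=
  (∃ c ∈ K * K, IsInvolution c ∧ ∀ d ∈ K * K, IsInvolution d → IsConj c d) ∧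
    ∀ k ∈ K, ¬ ∃ g : G, g ^ 2 = k

namespace Monoid.CoprodI

section ReducedLists

variable {ι : Type*} {M : ι → Type*} [∀ i, Group (M i)]

/-- A list of letters is reduced if it is the list underlying some `Monoid.CoprodI.Word`. -/
def IsReducedList (l : List (Σ i, M i)) : Prop :=
  (∀ p ∈ l, p.2 ≠ 1) ∧ l.IsChain fun p q => p.1 ≠ q.1

/-- The element of the free product spelled by a list of letters. -/
def evalList (l : List (Σ i, M i)) : CoprodI M :=
  (l.map fun p => of p.2).prod

/-- The formal inverse of a list of letters. -/
def invList (l : List (Σ i, M i)) : List (Σ i, M i) :=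
  (l.map fun p => ⟨p.1, p.2⁻¹⟩).reverse

@[simp]
theorem evalList_nil : evalList ([] : List (Σ i, M i)) = 1 := rfl

@[simp]
theorem evalList_cons (p : Σ i, M i) (l : List (Σ i, M i)) :
    evalList (p :: l) = of p.2 * evalList l := by
  simp [evalList]

@[simp]
theorem evalList_append (l l' : List (Σ i, M i)) :
    evalList (l ++ l') = evalList l * evalList l' := by
  simp [evalList]

@[simp]
theorem evalList_invList (l : List (Σ i, M i)) : evalList (invList l) = (evalList l)⁻¹ := by
  induction l with
  | nil => simp [invList]
  | cons p l ih =>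
    have : invList (p :: l) = invList l ++ [⟨p.1, p.2⁻¹⟩] := by simp [invList]
    rw [this]
    simp [ih]

theorem IsReducedList.invList {l : List (Σ i, M i)} (h : IsReducedList l) :
    IsReducedList (invList l) := by
  refine ⟨?_, ?_⟩
  · intro p hp
    simp only [CoprodI.invList, List.mem_reverse, List.mem_map] at hp
    obtain ⟨q, hq, rfl⟩ := hp
    simpa using h.1 q hq
  · rw [CoprodI.invList, List.isChain_reverse, List.isChain_map]
    exact h.2.imp fun p q hpq => hpq.symm

theorem exists_isReducedList (g : CoprodI M) : ∃ l, IsReducedList l ∧ evalList l = g := by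
  classical
  exact ⟨(Word.equiv g).toList, ⟨fun p hp => (Word.equiv g).ne_one p hp, (Word.equiv g).chain_ne⟩,
    Word.equiv.symm_apply_apply g⟩

theorem IsReducedList.eq_of_evalList_eq {l l' : List (Σ i, M i)} (h : IsReducedList l)
    (h' : IsReducedList l') (e : evalList l = evalList l') : l = l' := by
  classical
  have key : (⟨l, h.1, h.2⟩ : Word M) = ⟨l', h'.1, h'.2⟩ := Word.equiv.symm.injective e
  exact congrArg Word.toList key

theorem isReducedList_singleton {i : ι} {m : M i} (hm : m ≠ 1) :
    IsReducedList [(⟨i, m⟩ : Σ i, M i)] :=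
  ⟨by simpa using hm, List.isChain_singleton _⟩

theorem IsReducedList.of_infix {l l' : List (Σ i, M i)} (h : IsReducedList l) (hl : l' <:+: l) :
    IsReducedList l' :=
  ⟨fun p hp => h.1 p (hl.subset hp), h.2.infix hl⟩

/-- A reduced list can be split as a reduced list not ending in the factor `i`, times an element of
that factor. -/
theorem IsReducedList.exists_split_last {l : List (Σ i, M i)} (h : IsReducedList l) (i : ι) :
    ∃ l' : List (Σ i, M i), ∃ k : M i, IsReducedList l' ∧ l' <+: l ∧
      evalList l = evalList l' * of k ∧ ∀ p ∈ l'.getLast?, p.1 ≠ i := by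
  by_cases hl : ∀ p ∈ l.getLast?, p.1 ≠ i
  · exact ⟨l, 1, h, List.prefix_rfl, by simp, hl⟩
  · push Not at hl
    obtain ⟨p, hp, rfl⟩ := hl
    obtain ⟨l', rfl⟩ : ∃ l', l = l' ++ [p] := by
      rw [Option.mem_def, List.getLast?_eq_some_iff] at hp
      exact hp
    have hpre : l' <+: l' ++ [p] := List.prefix_append _ _
    refine ⟨l', p.2, h.of_infix hpre.isInfix, hpre, by simp, ?_⟩
    intro q hq
    exact (List.isChain_append.1 h.2).2.2 q hq p (by simp)

/-- A reduced list can be split as an element of the factor `i`, times a reduced list not starting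
in that factor. -/
theorem IsReducedList.exists_split_head {l : List (Σ i, M i)} (h : IsReducedList l) (i : ι) :
    ∃ l' : List (Σ i, M i), ∃ k : M i, IsReducedList l' ∧
      evalList l = of k * evalList l' ∧ ∀ p ∈ l'.head?, p.1 ≠ i := by
  by_cases hl : ∀ p ∈ l.head?, p.1 ≠ i
  · exact ⟨l, 1, h, by simp, hl⟩
  · push Not at hl
    obtain ⟨p, hp, rfl⟩ := hl
    obtain ⟨l', rfl⟩ : ∃ l', l = p :: l' := by
      rw [Option.mem_def, List.head?_eq_some_iff] at hp
      exact hp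
    refine ⟨l', p.2, h.of_infix (List.suffix_cons _ _).isInfix, by simp, ?_⟩
    intro q hq
    exact ((List.isChain_cons.1 h.2).1 q hq).symm

theorem IsReducedList.conj {l : List (Σ i, M i)} (h : IsReducedList l) {i : ι} {m : M i}
    (hm : m ≠ 1) (hl : ∀ p ∈ l.getLast?, p.1 ≠ i) :
    IsReducedList (l ++ ⟨i, m⟩ :: CoprodI.invList l) := by
  refine ⟨?_, ?_⟩
  · intro p hp
    rw [List.mem_append, List.mem_cons] at hp
    rcases hp with hp | rfl | hp
    · exact h.1 p hp
    · exact hm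
    · exact h.invList.1 p hp
  · rw [List.isChain_append, List.isChain_cons]
    refine ⟨h.2, ⟨?_, h.invList.2⟩, ?_⟩
    · intro q hq
      simp only [CoprodI.invList, List.head?_reverse, List.getLast?_map, Option.mem_def,
        Option.map_eq_some_iff] at hq
      obtain ⟨p, hp, rfl⟩ := hq
      exact (hl p hp).symm
    · intro p hp q hq
      simp only [List.head?_cons, Option.mem_def, Option.some.injEq] at hq
      subst hq
      exact hl p hp

/-- A factor of a free product is malnormal. -/
theorem mem_range_of_of_conj_eq {i : ι} {m m' : M i} (hm : m ≠ 1) {h : CoprodI M}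
    (e : h * of m * h⁻¹ = of m') : ∃ k : M i, h = of k := by
  obtain ⟨l, hl, rfl⟩ := exists_isReducedList h
  obtain ⟨l', k, hl', -, hk, hlast⟩ := hl.exists_split_last i
  have hm₁ : k * m * k⁻¹ ≠ 1 := by simpa using hm
  have hm' : m' ≠ 1 := by
    rintro rfl
    rw [map_one, conj_eq_one_iff] at e
    exact hm ((of_injective i) (by simpa using e))
  have heq : l' ++ ⟨i, k * m * k⁻¹⟩ :: invList l' = [⟨i, m'⟩] := by
    refine (hl'.conj hm₁ hlast).eq_of_evalList_eq (isReducedList_singleton hm') ?_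
    rw [hk] at e
    simp [← e, mul_assoc]
  have hnil : l' = [] := by
    have hlen := congrArg List.length heq
    simp only [List.length_append, List.length_cons, List.length_nil] at hlen
    exact List.length_eq_zero_iff.1 (by omega)
  exact ⟨k, by simp [hk, hnil]⟩

theorem exists_conj_of_mul_self_eq_one {z : CoprodI M} (hz : z ≠ 1) (hzz : z * z = 1) :
    ∃ (i : ι) (m : M i) (g : CoprodI M), m ≠ 1 ∧ m * m = 1 ∧ z = g * of m * g⁻¹ := by
  obtain ⟨l, hl, rfl⟩ := exists_isReducedList z
  have hinv : invList l = l :=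
    hl.invList.eq_of_evalList_eq hl (by rw [evalList_invList]; exact inv_eq_of_mul_eq_one_left hzz)
  clear hzz
  induction l using List.bidirectionalRec with
  | nil => simp at hz
  | singleton p =>
    refine ⟨p.1, p.2, 1, hl.1 p (by simp), ?_, by simp⟩
    obtain ⟨i, m⟩ := p
    have : m⁻¹ = m := by simpa [invList] using hinv
    exact inv_eq_iff_mul_eq_one.1 this
  | cons_append p l q ih =>
    have hsplit : invList (p :: (l ++ [q])) =
        ⟨q.1, q.2⁻¹⟩ :: (invList l ++ [⟨p.1, p.2⁻¹⟩]) := by simp [invList]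
    rw [hsplit, List.cons_eq_cons] at hinv
    obtain ⟨h₁, h₂⟩ := hinv
    obtain ⟨h₂, h₃⟩ := List.append_inj' h₂ rfl
    have h₃ : q = ⟨p.1, p.2⁻¹⟩ := (List.singleton_inj.1 h₃).symm
    have he : evalList (p :: (l ++ [q])) = of p.2 * evalList l * (of p.2)⁻¹ := by
      subst h₃
      simp [mul_assoc]
    have hne : evalList l ≠ 1 := by
      intro h
      rw [he, h] at hz
      simp at hz
    obtain ⟨i, m, g, hm, hmm, hg⟩ :=
      ih (hl.of_infix (l' := l) ⟨[p], [q], by simp⟩) hne h₂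
    refine ⟨i, m, of p.2 * g, hm, hmm, ?_⟩
    rw [he, hg]
    simp [mul_assoc]

end ReducedLists

section TwoFactors

variable {M : Bool → Type*} [∀ i, Group (M i)]

/-- If a free product `A * B` with `B` nontrivial is generated by `A` and the conjugate of `B` by
`g`, then `g ∈ A B`. -/
theorem exists_eq_mul_of_generates [Nontrivial (M false)] {g : CoprodI M}
    (hg : ∀ K : Subgroup (CoprodI M), (∀ a : M true, of a ∈ K) →
      (∀ b : M false, g * of b * g⁻¹ ∈ K) → K = ⊤) :
    ∃ (a : M true) (b : M false), g = of a * of b := by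
  obtain ⟨l₀, hl₀, rfl⟩ := exists_isReducedList g
  obtain ⟨l₁, a, hl₁, ha, hhead⟩ := hl₀.exists_split_head true
  obtain ⟨l, b, hl, hpre, hb, hlast⟩ := hl₁.exists_split_last false
  have hsplit : evalList l₀ = of a * evalList l * of b := by rw [ha, hb, mul_assoc]
  suffices hnil : l = [] by exact ⟨a, b, by simp [hsplit, hnil]⟩
  by_contra hne
  replace hhead : ∀ p ∈ l.head?, p.1 = false := by
    intro p hp
    rw [← Bool.not_eq_true]
    refine hhead p ?_
    obtain ⟨r, rfl⟩ := hpre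
    rwa [List.head?_append_of_ne_nil _ hne]
  let k : Bool → CoprodI M := fun i => if i then 1 else evalList l
  let ρ : CoprodI M →* CoprodI M := lift fun i => (MulAut.conj (k i)).toMonoidHom.comp of
  have hρtrue : ∀ c : M true, ρ (of c) = of c := fun c => by simp [ρ, k]
  have hρfalse : ∀ c : M false, ρ (of c) = evalList l * of c * (evalList l)⁻¹ :=
    fun c => by simp [ρ, k]
  have hρ : ρ.range = ⊤ := by
    have hA : ∀ c : M true, of c ∈ ρ.range := fun c => ⟨of c, hρtrue c⟩
    refine hg _ hA fun c => ?_
    have : evalList l₀ * of c * (evalList l₀)⁻¹ =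
        of a * (evalList l * of (b * c * b⁻¹) * (evalList l)⁻¹) * (of a)⁻¹ := by
      rw [hsplit]
      simp [mul_assoc]
    rw [this]
    exact mul_mem (mul_mem (hA a) ⟨of (b * c * b⁻¹), hρfalse _⟩) (inv_mem (hA a))
  let E : (Σ i, M i) → List (Σ i, M i) := fun p =>
    if p.1 then [p] else l ++ p :: invList l
  have hE_ne : ∀ p, E p ≠ [] := by
    intro p
    by_cases hp : p.1 <;> simp [E, hp]
  have hE_head : ∀ p, ∀ q ∈ (E p).head?, q.1 = p.1 := by
    intro p q hq
    by_cases hp : p.1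
    · simp only [E, hp, if_true, List.head?_cons, Option.mem_def, Option.some.injEq] at hq
      rw [← hq]
    · simp only [E, hp] at hq
      rw [if_neg (by simp), List.head?_append_of_ne_nil _ hne] at hq
      rw [hhead q hq]
      simpa using hp
  have hE_last : ∀ p, ∀ q ∈ (E p).getLast?, q.1 = p.1 := by
    intro p q hq
    by_cases hp : p.1
    · simp only [E, hp, if_true, List.getLast?_singleton, Option.mem_def, Option.some.injEq] at hq
      rw [← hq]
    · have hinv : invList l ≠ [] := by simpa [invList] using hne
      simp only [E, hp] at hq
      rw [if_neg (by simp), ← List.singleton_append, ← List.append_assoc,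
        List.getLast?_append_of_ne_nil _ hinv] at hq
      simp only [invList, List.getLast?_reverse, List.head?_map, Option.mem_def,
        Option.map_eq_some_iff] at hq
      obtain ⟨r, hr, rfl⟩ := hq
      rw [hhead r hr]
      simpa using hp
  have hE_red : ∀ p : Σ i, M i, p.2 ≠ 1 → IsReducedList (E p) := by
    rintro ⟨i, m⟩ hm
    cases i
    · exact hl.conj hm hlast
    · exact isReducedList_singleton hm
  have hE_eval : ∀ p, evalList (E p) = ρ (of p.2) := by
    rintro ⟨i, m⟩
    cases i
    · rw [hρfalse]
      simp [E, mul_assoc]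
    · rw [hρtrue]
      simp [E]
  have hflat_eval : ∀ w : List (Σ i, M i), evalList (w.map E).flatten = ρ (evalList w) := by
    intro w
    induction w with
    | nil => simp
    | cons p w ih => simp [ih, hE_eval]
  have hflat_red : ∀ w : List (Σ i, M i), IsReducedList w → IsReducedList (w.map E).flatten := by
    intro w hw
    refine ⟨?_, ?_⟩
    · intro p hp
      simp only [List.mem_flatten, List.mem_map] at hp
      obtain ⟨_, ⟨q, hq, rfl⟩, hp⟩ := hp
      exact (hE_red q (hw.1 q hq)).1 p hp
    · have hmem : [] ∉ w.map E := fun h => by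
        obtain ⟨p, -, hp⟩ := List.mem_map.1 h
        exact hE_ne p hp
      rw [List.isChain_flatten hmem, List.isChain_map]
      refine ⟨?_, hw.2.imp ?_⟩
      · intro r hr
        obtain ⟨q, hq, rfl⟩ := List.mem_map.1 hr
        exact (hE_red q (hw.1 q hq)).2
      · intro p q hpq r hr s hs
        rw [hE_last p r hr, hE_head q s hs]
        exact hpq
  obtain ⟨m₀, hm₀⟩ := exists_ne (1 : M false)
  obtain ⟨h, hh⟩ : (of m₀ : CoprodI M) ∈ ρ.range := by rw [hρ]; trivial
  obtain ⟨w, hw, rfl⟩ := exists_isReducedList h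
  have heq : (w.map E).flatten = [⟨false, m₀⟩] := by
    refine (hflat_red w hw).eq_of_evalList_eq (isReducedList_singleton hm₀) ?_
    rw [hflat_eval, hh]
    simp
  cases w with
  | nil => simp at heq
  | cons p w =>
    obtain ⟨i, m⟩ := p
    cases i
    · have hlen := congrArg List.length heq
      have hpos := List.length_pos_iff.2 hne
      rw [List.map_cons, List.flatten_cons, List.length_append] at hlen
      simp only [E, Bool.false_eq_true, if_false, List.length_append, List.length_cons,
        List.length_nil] at hlen
      omega
    · simp [E] at heq

end TwoFactors

end Monoid.CoprodI

/-- The homomorphism from `ℤˣ` sending `-1` to a given element of square `1`. -/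
def unitsIntHom {G : Type*} [Group G] (s : G) (hs : s * s = 1) : ℤˣ →* G where
  toFun e := if e = 1 then 1 else s
  map_one' := by simp
  map_mul' a b := by
    have h : (-1 : ℤˣ) ≠ 1 := by decide
    rcases Int.units_eq_one_or a with rfl | rfl <;> rcases Int.units_eq_one_or b with rfl | rfl <;>
      simp [h, hs]

@[simp]
theorem unitsIntHom_neg_one {G : Type*} [Group G] (s : G) (hs : s * s = 1) :
    unitsIntHom s hs (-1) = s := by
  have h : (-1 : ℤˣ) ≠ 1 := by decide
  simp [unitsIntHom, h]

theorem unitsInt_hom_ext {G : Type*} [Group G] {f g : ℤˣ →* G} (h : f (-1) = g (-1)) : f = g := by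
  ext e
  rcases Int.units_eq_one_or e with rfl | rfl
  · simp
  · exact h

section CoprodAut

open Monoid.CoprodI

/-- The free product of two groups of the form `ℤˣ × FreeGroup (S i)`. -/
abbrev SignedCoprod (S : Bool → Type*) : Type _ :=
  Monoid.CoprodI fun i => ℤˣ × FreeGroup (S i)

variable {S : Bool → Type*}

/-- The inclusion of the factor `i` of `SignedCoprod S`. -/
abbrev SignedCoprod.incl (i : Bool) : ℤˣ × FreeGroup (S i) →* SignedCoprod S :=
  Monoid.CoprodI.of (M := fun i => ℤˣ × FreeGroup (S i)) (i := i)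

/-- The central involution of the factor `i` of `SignedCoprod S`. -/
def SignedCoprod.sign (i : Bool) : SignedCoprod S :=
  incl i (-1, 1)

open SignedCoprod

theorem neg_one_prod_ne_one {α : Type*} : ((-1, 1) : ℤˣ × FreeGroup α) ≠ 1 := by
  simp [Prod.ext_iff]

theorem eq_neg_one_of_mul_self {α : Type*} {m : ℤˣ × FreeGroup α} (hm : m ≠ 1)
    (hmm : m * m = 1) : m = (-1, 1) := by
  obtain ⟨e, w⟩ := m
  have hw : w = 1 := by
    have : w ^ 2 = 1 := by rw [pow_two]; exact congrArg Prod.snd hmm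
    exact (pow_eq_one_iff_left two_ne_zero).1 this
  subst hw
  rcases Int.units_eq_one_or e with rfl | rfl
  · exact absurd rfl hm
  · rfl

instance {α : Type*} : Nontrivial (ℤˣ × FreeGroup α) :=
  ⟨_, _, neg_one_prod_ne_one⟩

theorem SignedCoprod.sign_mul_self (i : Bool) : (sign i : SignedCoprod S) * sign i = 1 := by
  rw [sign, ← map_mul]
  simp only [Prod.mk_mul_mk, mul_one, neg_mul_neg]
  exact map_one _

theorem SignedCoprod.sign_commute (i : Bool) (m : ℤˣ × FreeGroup (S i)) :
    (sign i : SignedCoprod S) * incl i m = incl i m * sign i := by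
  rw [sign, ← map_mul, ← map_mul]
  congr 1
  ext <;> simp [mul_comm]

theorem SignedCoprod.eq_of_commute_sign {i : Bool} {h : SignedCoprod S}
    (hh : h * sign i = sign i * h) : ∃ m : ℤˣ × FreeGroup (S i), h = incl i m :=
  mem_range_of_of_conj_eq (M := fun i => ℤˣ × FreeGroup (S i)) (m' := (-1, 1))
    neg_one_prod_ne_one (mul_inv_eq_iff_eq_mul.2 hh)

theorem SignedCoprod.sign_not_conj (g : SignedCoprod S) :
    (sign false : SignedCoprod S) ≠ g * sign true * g⁻¹ := by
  intro h
  let χ : SignedCoprod S →* ℤˣ :=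
    lift fun i => if i then MonoidHom.fst _ _ else 1
  have hχ := congrArg χ h
  have h₁ : χ (sign false) = 1 := by simp [χ, sign]
  have h₂ : χ (sign true) = -1 := by simp [χ, sign]
  rw [map_mul, map_mul, map_inv, h₁, h₂, mul_comm, inv_mul_cancel_left] at hχ
  exact absurd hχ (by decide)

/-- An automorphism fixing the central involution of the first factor maps the second factor to a
conjugate of itself by an element of the first factor. -/
theorem SignedCoprod.exists_conj_of_map_sign (τ : SignedCoprod S ≃* SignedCoprod S)
    (hτ : τ (sign true) = sign true) :
    ∃ a : ℤˣ × FreeGroup (S true), τ (sign false) = incl true a * sign false * (incl true a)⁻¹ ∧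
      ∀ b : ℤˣ × FreeGroup (S false), ∃ b' : ℤˣ × FreeGroup (S false),
        τ (incl false b) = incl true a * incl false b' * (incl true a)⁻¹ := by
  obtain ⟨g, hg⟩ : ∃ g, τ (sign false) = g * sign false * g⁻¹ := by
    have hne : τ (sign false) ≠ 1 := by
      rw [Ne, MulEquiv.map_eq_one_iff]
      intro h
      exact neg_one_prod_ne_one
        (of_injective (M := fun i => ℤˣ × FreeGroup (S i)) false (h.trans (map_one _).symm))
    obtain ⟨i, m, g, hm, hmm, hg⟩ := exists_conj_of_mul_self_eq_one hne
      (by rw [← map_mul, sign_mul_self, map_one])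
    obtain rfl := eq_neg_one_of_mul_self hm hmm
    cases i
    · exact ⟨g, hg⟩
    · refine absurd ?_ (sign_not_conj (τ.symm g))
      apply τ.injective
      rw [map_mul, map_mul, map_inv, τ.apply_symm_apply, hτ]
      exact hg
  have hA (a : ℤˣ × FreeGroup (S true)) :
      ∃ a' : ℤˣ × FreeGroup (S true), τ (incl true a) = incl true a' := by
    apply eq_of_commute_sign
    rw [← hτ, ← map_mul, ← map_mul, sign_commute]
  have hBg (b : ℤˣ × FreeGroup (S false)) :
      ∃ b' : ℤˣ × FreeGroup (S false), τ (incl false b) = g * incl false b' * g⁻¹ := by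
    obtain ⟨b', hb'⟩ : ∃ b' : ℤˣ × FreeGroup (S false), g⁻¹ * τ (incl false b) * g = incl false b' := by
      apply eq_of_commute_sign
      have h : τ (incl false b) * (g * sign false * g⁻¹) = (g * sign false * g⁻¹) * τ (incl false b) := by
        rw [← hg, ← map_mul, ← map_mul, sign_commute]
      calc g⁻¹ * τ (incl false b) * g * sign false
          = g⁻¹ * (τ (incl false b) * (g * sign false * g⁻¹)) * g := by group
        _ = sign false * (g⁻¹ * τ (incl false b) * g) := by rw [h]; group
    exact ⟨b', by rw [← hb']; group⟩
  obtain ⟨a, b, rfl⟩ :=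
    exists_eq_mul_of_generates (M := fun i => ℤˣ × FreeGroup (S i)) (g := g) (by
      intro K hKA hKB
      rw [eq_top_iff]
      rintro z -
      have hz : ∀ w, τ w ∈ K := by
        intro w
        induction w using Monoid.CoprodI.induction_on with
        | one => rw [map_one]; exact K.one_mem
        | of i m =>
          cases i
          · obtain ⟨b', hb'⟩ := hBg m
            exact hb' ▸ hKB b'
          · obtain ⟨a', ha'⟩ := hA m
            exact ha' ▸ hKA a'
        | mul u v hu hv => rw [map_mul]; exact K.mul_mem hu hv
      simpa using hz (τ.symm z))
  refine ⟨a, ?_, fun c => ?_⟩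
  · rw [hg, mul_assoc (incl true a), ← sign_commute]
    group
  · obtain ⟨c', hc'⟩ := hBg c
    refine ⟨b * c' * b⁻¹, ?_⟩
    rw [hc', map_mul, map_mul, map_inv]
    group

end CoprodAut

section Basis

variable {X : Type*} {B : Set (FreeGroup X)} {H : Type*} [Group H]

theorem FreeGroup.IsBasis.exists_hom (hB : FreeGroup.IsBasis B) (f : FreeGroup X → H) :
    ∃ F : FreeGroup X →* H, ∀ b ∈ B, F b = f b := by
  let e := MulEquiv.ofBijective _ hB
  refine ⟨(FreeGroup.lift fun b : B => f b).comp e.symm.toMonoidHom, fun b hb => ?_⟩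
  have he : e.symm b = FreeGroup.of ⟨b, hb⟩ := by
    rw [MulEquiv.symm_apply_eq]
    exact (FreeGroup.lift_apply_of (f := fun s : B => (s : FreeGroup X)) (x := ⟨b, hb⟩)).symm
  simp [he]

theorem FreeGroup.IsBasis.hom_ext (hB : FreeGroup.IsBasis B) {f g : FreeGroup X →* H}
    (h : ∀ b ∈ B, f b = g b) : f = g := by
  have key : f.comp (FreeGroup.lift fun b : B => (b : FreeGroup X)) =
      g.comp (FreeGroup.lift fun b : B => (b : FreeGroup X)) := by
    ext b
    simpa using h b b.2
  ext z
  obtain ⟨w, hw⟩ := hB.2 (FreeGroup.of z)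
  rw [← hw]
  exact DFunLike.congr_fun key w

end Basis

section Transport

open SignedCoprod

variable {X : Type*}

/-- The homomorphism from the free group on a subset of a free group extending the inclusion. -/
abbrev FreeGroup.inclHom (V : Set (FreeGroup X)) : FreeGroup V →* FreeGroup X :=
  FreeGroup.lift fun v : V => (v : FreeGroup X)

theorem FreeGroup.inclHom_mem_closure {V : Set (FreeGroup X)} (w : FreeGroup V) :
    FreeGroup.inclHom V w ∈ Subgroup.closure V := by
  have h : (FreeGroup.inclHom V).range ≤ Subgroup.closure V := by
    rw [FreeGroup.range_lift_eq_closure, Subtype.range_coe]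
  exact h ⟨w, rfl⟩

theorem IsCanonicalBasis.apply_inclHom {φ : MulAut (FreeGroup X)} {U S : Set (FreeGroup X)}
    {Y : FreeGroup X → Set (FreeGroup X)} (hB : IsCanonicalBasis φ U S Y) (w : FreeGroup U) :
    φ (FreeGroup.inclHom U w) = FreeGroup.inclHom U w := by
  have h : φ.toMonoidHom.comp (FreeGroup.inclHom U) = FreeGroup.inclHom U := by
    ext u
    simpa using hB.2.1 u u.2
  exact DFunLike.congr_fun h w

theorem IsCanonicalBasis.apply_inclHom_conj {φ : MulAut (FreeGroup X)} {U Y : Set (FreeGroup X)}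
    {x : FreeGroup X} (hB : IsCanonicalBasis φ U {x} (fun _ => Y)) (w : FreeGroup Y) :
    φ (FreeGroup.inclHom Y w) = x * FreeGroup.inclHom Y w * x⁻¹ := by
  have h : φ.toMonoidHom.comp (FreeGroup.inclHom Y) =
      (MulAut.conj x).toMonoidHom.comp (FreeGroup.inclHom Y) := by
    ext y
    simpa using hB.2.2.2 x rfl y y.2
  exact DFunLike.congr_fun h w

/-- The two index sets `U` and `Y` as a family indexed by `Bool`. -/
abbrev boolFamily (U Y : Set (FreeGroup X)) (i : Bool) : Set (FreeGroup X) :=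
  bif i then U else Y

/-- For a `1`-involution `φ` with canonical basis `U ⊔ {x} ⊔ Y`, the semidirect product of the free
group with `⟨φ⟩` is the free product of `⟨φ⟩ × ⟨U⟩` and `⟨x⁻¹ φ⟩ × ⟨Y⟩`. -/
theorem exists_mulEquiv_signedCoprod {φ : MulAut (FreeGroup X)} (hφ : φ * φ = 1)
    {U Y : Set (FreeGroup X)} {x : FreeGroup X} (hB : IsCanonicalBasis φ U {x} (fun _ => Y)) :
    ∃ θ : (FreeGroup X ⋊[unitsIntHom φ hφ] ℤˣ) ≃* SignedCoprod (fun i => boolFamily U Y i),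
      θ (SemidirectProduct.inr (-1)) = sign true ∧
      θ (SemidirectProduct.inl x) = sign true * sign false ∧
      (∀ w : FreeGroup U, θ (SemidirectProduct.inl (FreeGroup.inclHom U w)) = incl true (1, w)) ∧
      ∀ w : FreeGroup Y, θ (SemidirectProduct.inl (FreeGroup.inclHom Y w)) =
        incl false (1, w) := by
  classical
  have hφw := hB.apply_inclHom_conj
  have hφv := hB.apply_inclHom
  obtain ⟨⟨hbasis, hUS, hUY, hSY, -⟩, hφU, hφx, hφY⟩ := hB
  replace hφx : φ x = x⁻¹ := hφx x rfl
  replace hφY : ∀ y ∈ Y, φ y = x * y * x⁻¹ := hφY x rfl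
  have hbasis : FreeGroup.IsBasis (U ∪ {x} ∪ Y) := by simpa using hbasis
  have hxU : x ∉ U := by simpa using hUS
  have hxY : x ∉ Y := by simpa using hSY x rfl
  have hYU : ∀ y ∈ Y, y ∉ U := fun y hy hy' => (hUY x rfl).ne_of_mem hy' hy rfl
  have hext {H : Type _} [Group H] {f g : FreeGroup X →* H} (hx : f x = g x)
      (hu : ∀ u ∈ U, f u = g u) (hy : ∀ y ∈ Y, f y = g y) : f = g := by
    refine hbasis.hom_ext ?_
    rintro b ((hb | rfl) | hb)
    exacts [hu b hb, hx, hy b hb]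
  -- The homomorphism to the free product.
  obtain ⟨fn, hfn⟩ := hbasis.exists_hom (H := SignedCoprod fun i => boolFamily U Y i) fun b =>
    if h : b ∈ U then incl true (1, FreeGroup.of ⟨b, h⟩)
    else if h : b ∈ Y then incl false (1, FreeGroup.of ⟨b, h⟩) else sign true * sign false
  have hfnx : fn x = sign true * sign false := by
    rw [hfn x (by simp), dif_neg hxU, dif_neg hxY]
  have hfnU : ∀ u (hu : u ∈ U), fn u = incl true (1, FreeGroup.of ⟨u, hu⟩) := by
    intro u hu
    rw [hfn u (by simp [hu]), dif_pos hu]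
  have hfnY : ∀ y (hy : y ∈ Y), fn y = incl false (1, FreeGroup.of ⟨y, hy⟩) := by
    intro y hy
    rw [hfn y (by simp [hy]), dif_neg (hYU y hy), dif_pos hy]
  have hfnv (w : FreeGroup U) : fn (FreeGroup.inclHom U w) = incl true (1, w) := by
    have : fn.comp (FreeGroup.inclHom U) = (incl (S := fun i => boolFamily U Y i) true).comp (MonoidHom.inr _ _) := by
      ext u
      simpa using hfnU u u.2
    exact DFunLike.congr_fun this w
  have hfnw (w : FreeGroup Y) : fn (FreeGroup.inclHom Y w) = incl false (1, w) := by
    have : fn.comp (FreeGroup.inclHom Y) = (incl (S := fun i => boolFamily U Y i) false).comp (MonoidHom.inr _ _) := by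
      ext y
      simpa using hfnY y y.2
    exact DFunLike.congr_fun this w
  have hinv (i : Bool) : (sign i : SignedCoprod fun i => boolFamily U Y i)⁻¹ = sign i :=
    inv_eq_of_mul_eq_one_left (SignedCoprod.sign_mul_self i)
  let fg : ℤˣ →* SignedCoprod fun i => boolFamily U Y i :=
    (incl true).comp (MonoidHom.inl _ _)
  have hfg : fg (-1) = sign true := rfl
  have hcompat : ∀ e : ℤˣ, fn.comp (unitsIntHom φ hφ e).toMonoidHom =
      (MulAut.conj (fg e)).toMonoidHom.comp fn := by
    intro e
    rcases Int.units_eq_one_or e with rfl | rfl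
    · ext z
      simp
    · rw [unitsIntHom_neg_one, hfg]
      refine hext ?_ (fun u hu => ?_) (fun y hy => ?_)
      · simp [hφx, hfnx, hinv, ← mul_assoc, SignedCoprod.sign_mul_self]
      · simp only [MonoidHom.comp_apply, MulEquiv.toMonoidHom_eq_coe, MonoidHom.coe_coe,
          MulAut.conj_apply]
        rw [hφU u hu, hfnU u hu, sign_commute, mul_inv_cancel_right]
      · simp only [MonoidHom.comp_apply, MulEquiv.toMonoidHom_eq_coe, MonoidHom.coe_coe,
          MulAut.conj_apply]
        rw [hφY y hy, map_mul, map_mul, map_inv, hfnx, hfnY y hy, mul_assoc (sign true),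
          sign_commute]
        group
  let T := SemidirectProduct.lift fn fg hcompat
  -- The homomorphism from the free product.
  let s : FreeGroup X ⋊[unitsIntHom φ hφ] ℤˣ :=
    SemidirectProduct.inl x⁻¹ * SemidirectProduct.inr (-1)
  have hss : s * s = 1 := by
    ext <;> simp [s, hφx]
  have hs_comm (w : FreeGroup Y) : Commute s (SemidirectProduct.inl (FreeGroup.inclHom Y w)) := by
    ext1
    · simp [s, hφw, mul_assoc]
    · simp [s]
  have ht_comm (w : FreeGroup U) : Commute (SemidirectProduct.inr (-1) :
      FreeGroup X ⋊[unitsIntHom φ hφ] ℤˣ) (SemidirectProduct.inl (FreeGroup.inclHom U w)) := by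
    ext1
    · simp [hφv]
    · simp
  let κtrue : ℤˣ × FreeGroup U →* FreeGroup X ⋊[unitsIntHom φ hφ] ℤˣ :=
    MonoidHom.noncommCoprod SemidirectProduct.inr
      (SemidirectProduct.inl.comp (FreeGroup.inclHom U)) (by
        intro e w
        rcases Int.units_eq_one_or e with rfl | rfl
        · simp
        · exact ht_comm w)
  let κfalse : ℤˣ × FreeGroup Y →* FreeGroup X ⋊[unitsIntHom φ hφ] ℤˣ :=
    MonoidHom.noncommCoprod (unitsIntHom s hss)
      (SemidirectProduct.inl.comp (FreeGroup.inclHom Y)) (by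
        intro e w
        rcases Int.units_eq_one_or e with rfl | rfl
        · simp
        · simpa using hs_comm w)
  let κ : SignedCoprod (fun i => boolFamily U Y i) →* FreeGroup X ⋊[unitsIntHom φ hφ] ℤˣ :=
    Monoid.CoprodI.lift fun i => match i with
      | true => κtrue
      | false => κfalse
  have hκtrue (e : ℤˣ) (w : FreeGroup U) : κ (incl true (e, w)) =
      SemidirectProduct.inr e * SemidirectProduct.inl (FreeGroup.inclHom U w) :=
    Monoid.CoprodI.lift_of _ _
  have hκfalse (e : ℤˣ) (w : FreeGroup Y) : κ (incl false (e, w)) =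
      unitsIntHom s hss e * SemidirectProduct.inl (FreeGroup.inclHom Y w) :=
    Monoid.CoprodI.lift_of _ _
  have hTs (e : ℤˣ) : T (unitsIntHom s hss e) = incl false (e, 1) := by
    have : T.comp (unitsIntHom s hss) = (incl false).comp (MonoidHom.inl _ _) := by
      refine unitsInt_hom_ext ?_
      simp only [MonoidHom.comp_apply, unitsIntHom_neg_one, MonoidHom.inl_apply]
      change T s = sign false
      simp only [T, s, map_mul, SemidirectProduct.lift_inl, SemidirectProduct.lift_inr, map_inv,
        hfnx, hfg, mul_inv_rev, hinv]
      rw [mul_assoc, SignedCoprod.sign_mul_self, mul_one]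
    exact DFunLike.congr_fun this e
  have hκT : κ.comp T = MonoidHom.id _ := by
    refine SemidirectProduct.hom_ext (hext ?_ (fun u hu => ?_) (fun y hy => ?_)) ?_
    · simp only [MonoidHom.comp_apply, T, SemidirectProduct.lift_inl, hfnx, map_mul,
        MonoidHom.id_apply]
      rw [sign, sign, hκtrue, hκfalse]
      ext <;> simp [s, hφx]
    · simp only [MonoidHom.comp_apply, T, SemidirectProduct.lift_inl, hfnU u hu, MonoidHom.id_apply]
      rw [hκtrue]
      simp
    · simp only [MonoidHom.comp_apply, T, SemidirectProduct.lift_inl, hfnY y hy, MonoidHom.id_apply]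
      rw [hκfalse]
      simp
    · ext1 e
      simp only [MonoidHom.comp_apply, T, SemidirectProduct.lift_inr, MonoidHom.id_apply, fg,
        MonoidHom.inl_apply]
      rw [hκtrue]
      simp
  have hTκ : T.comp κ = MonoidHom.id _ := by
    refine Monoid.CoprodI.ext_hom _ _ fun i => ?_
    ext1 m
    obtain ⟨e, w⟩ := m
    cases i
    · change T (κ (incl false (e, w))) = incl false (e, w)
      rw [hκfalse, map_mul, hTs, SemidirectProduct.lift_inl, hfnw, ← map_mul]
      simp
    · change T (κ (incl true (e, w))) = incl true (e, w)
      rw [hκtrue, map_mul, SemidirectProduct.lift_inl, SemidirectProduct.lift_inr, hfnv]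
      simp only [fg, MonoidHom.comp_apply, MonoidHom.inl_apply]
      rw [← map_mul]
      simp
  refine ⟨MonoidHom.toMulEquiv T κ hκT hTκ, ?_, ?_, fun w => ?_, fun w => ?_⟩
  · exact (SemidirectProduct.lift_inr (h := hcompat) ..).trans hfg
  · exact (SemidirectProduct.lift_inl (h := hcompat) ..).trans hfnx
  · exact (SemidirectProduct.lift_inl (h := hcompat) ..).trans (hfnv w)
  · exact (SemidirectProduct.lift_inl (h := hcompat) ..).trans (hfnw w)

end Transport

/-- Let `φ ∈ Aut F` be a `1`-involution with canonical basis `{x} ⊔ Y ⊔ U`, where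
`|Y| < |U| = κ = rank F`. If `σ ∈ Aut F` commutes with `φ`, then `σx = v x^ε v⁻¹` for a
suitable `v ∈ ⟨U⟩` and `ε = ±1`; moreover, if `Y` is nonempty, then for every `y ∈ Y` the
element `σy` lies in a conjugate of the subgroup `⟨Y⟩`. -/
theorem centralizer_of_one_involution_action (X : Type*) [Infinite X]
    (φ : MulAut (FreeGroup X)) (hφ : IsInvolution φ)
    (U Y : Set (FreeGroup X)) (x : FreeGroup X)
    (hB : IsCanonicalBasis φ U {x} (fun _ => Y))
    (hYU : Cardinal.mk Y < Cardinal.mk U)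
    (hU : Cardinal.mk U = Cardinal.mk X)
    (σ : MulAut (FreeGroup X)) (hσ : σ * φ = φ * σ) :
    (∃ v ∈ Subgroup.closure U, σ x = v * x * v⁻¹ ∨ σ x = v * x⁻¹ * v⁻¹) ∧
    (Y.Nonempty → ∀ y ∈ Y, ∃ w : FreeGroup X, ∃ g ∈ Subgroup.closure Y,
      σ y = w * g * w⁻¹) := by
  have hφφ : φ * φ = 1 := by rw [← pow_two]; exact hφ.2
  obtain ⟨θ, hθt, hθx, hθU, hθY⟩ := exists_mulEquiv_signedCoprod hφφ hB
  let σ' : (FreeGroup X ⋊[unitsIntHom φ hφφ] ℤˣ) ≃* (FreeGroup X ⋊[unitsIntHom φ hφφ] ℤˣ) :=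
    SemidirectProduct.congr σ (MulEquiv.refl _) (by
      intro e
      rcases Int.units_eq_one_or e with rfl | rfl
      · ext z
        simp
      · ext1 z
        simpa using DFunLike.congr_fun hσ z)
  have hσl (z : FreeGroup X) : σ' (SemidirectProduct.inl z) = SemidirectProduct.inl (σ z) := rfl
  have hσr (e : ℤˣ) : σ' (SemidirectProduct.inr e) = SemidirectProduct.inr e := by
    ext <;> simp [σ']
  let τ := (θ.symm.trans σ').trans θ
  have hτ (z) : τ (θ z) = θ (σ' z) := by simp [τ]
  obtain ⟨⟨ε, w⟩, hs, hb⟩ := SignedCoprod.exists_conj_of_map_sign τ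
    (by rw [← hθt, hτ, hσr])
  set v : FreeGroup X := FreeGroup.inclHom U w with hv
  have ha : SignedCoprod.incl true (ε, w) =
      θ (SemidirectProduct.inl v * SemidirectProduct.inr ε) := by
    have hε : θ (SemidirectProduct.inr ε) = SignedCoprod.incl true (ε, 1) := by
      rcases Int.units_eq_one_or ε with rfl | rfl
      · rw [map_one, map_one]
        exact (map_one (SignedCoprod.incl true)).symm
      · exact hθt
    rw [map_mul, hε, hv, hθU, ← map_mul]
    simp
  have hsf : SignedCoprod.sign false =
      θ (SemidirectProduct.inr (-1) * SemidirectProduct.inl x) := by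
    rw [map_mul, hθt, hθx, ← mul_assoc, SignedCoprod.sign_mul_self, one_mul]
  have hφφ_apply (z : FreeGroup X) : φ (φ z) = z := DFunLike.congr_fun hφφ z
  have hφx : φ x = x⁻¹ := hB.2.2.1 x rfl
  refine ⟨⟨v, FreeGroup.inclHom_mem_closure w, ?_⟩, fun _ y hy => ?_⟩
  · rw [ha, hsf, hτ, ← map_mul, ← map_inv, ← map_mul, θ.injective.eq_iff, map_mul, hσr, hσl] at hs
    have hσx := congrArg SemidirectProduct.left
      (congrArg (SemidirectProduct.inr (-1) * ·) hs)
    have hφv : φ v = v := hB.apply_inclHom w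
    rcases Int.units_eq_one_or ε with rfl | rfl
    · left
      simpa [hφφ_apply, hφv, hφx] using hσx
    · right
      simpa [hφφ_apply, hφv, hφx] using hσx
  · obtain ⟨⟨δ, g⟩, hg⟩ := hb (1, FreeGroup.of ⟨y, hy⟩)
    have hy' : SignedCoprod.incl false (1, FreeGroup.of ⟨y, hy⟩) = θ (SemidirectProduct.inl y) := by
      rw [← hθY]
      simp
    have hδ : SignedCoprod.incl false (δ, g) =
        SignedCoprod.incl false (δ, 1) * θ (SemidirectProduct.inl (FreeGroup.inclHom Y g)) := by
      rw [hθY, ← map_mul]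
      simp
    rw [hδ, hy', hτ, hσl, ha] at hg
    rcases Int.units_eq_one_or δ with rfl | rfl
    · have h1 : SignedCoprod.incl false ((1, 1) : ℤˣ × FreeGroup Y) =
          (1 : SignedCoprod fun i => boolFamily U Y i) := map_one _
      rw [h1, one_mul, ← map_mul, ← map_inv, ← map_mul, θ.injective.eq_iff] at hg
      have hσy := congrArg SemidirectProduct.left hg
      rcases Int.units_eq_one_or ε with rfl | rfl
      · exact ⟨v, _, FreeGroup.inclHom_mem_closure g, by simpa using hσy⟩
      · have hφg := hB.apply_inclHom_conj g
        refine ⟨v * x, _, FreeGroup.inclHom_mem_closure g, ?_⟩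
        simpa [hφg, hφφ_apply, mul_assoc] using hσy
    · exfalso
      change _ = _ * (SignedCoprod.sign false * _) * _ at hg
      rw [hsf, ← map_mul, ← map_mul, ← map_inv, ← map_mul, θ.injective.eq_iff] at hg
      have hr := congrArg SemidirectProduct.rightHom hg
      simp at hr
end

section
/- Let φ ∈ Aut(F) be an extremal involution and let K be the conjugacy class of φ̂ in Out(F). Then the product set K·K contains exactly one conjugacy class of involutions of Out(F), and no element of K is a square in Out(F); in other words, the conjugacy class of extremal involutions in Out(F) satisfies condition (★). -/
open Pointwise

namespace FreeGroup

variable {ι : Type*}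

theorem mk_cons (l : ι × Bool) (W : List (ι × Bool)) : mk (l :: W) = mk [l] * mk W := by
  simp [mul_mk]

theorem eq_of_mk_eq_mk [DecidableEq ι] {V W : List (ι × Bool)} (hV : IsReduced V)
    (hW : IsReduced W) (h : mk V = mk W) : V = W := by
  rw [← hV.reduce_eq, ← hW.reduce_eq, ← toWord_mk, ← toWord_mk, h]

theorem mk_letter_false (i : ι) : (mk [(i, false)] : FreeGroup ι) = (of i)⁻¹ := by
  simp [of, inv_mk, invRev]

theorem mk_mem_closure_of {s : Set ι} {W : List (ι × Bool)} (h : ∀ l ∈ W, l.1 ∈ s) :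
    mk W ∈ Subgroup.closure (of '' s) := by
  induction W with
  | nil => exact one_mem _
  | cons l W ih =>
    rw [mk_cons]
    refine mul_mem ?_ (ih fun l' hl' => h l' (List.mem_cons_of_mem _ hl'))
    have hl : of l.1 ∈ Subgroup.closure (of '' s) :=
      Subgroup.subset_closure ⟨l.1, h l List.mem_cons_self, rfl⟩
    obtain ⟨j, _ | _⟩ := l
    · rw [mk_letter_false]; exact inv_mem hl
    · exact hl

variable [DecidableEq ι]

/-- The endomorphism of a free group inverting the generator `i` and fixing all others. -/
def flipHom (i : ι) : FreeGroup ι →* FreeGroup ι :=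
  lift fun j => if j = i then (of j)⁻¹ else of j

/-- The action of `flipHom i` on letters. -/
def flipLetter (i : ι) (l : ι × Bool) : ι × Bool :=
  (l.1, if l.1 = i then !l.2 else l.2)

theorem flipHom_mk (i : ι) (W : List (ι × Bool)) :
    flipHom i (mk W) = mk (W.map (flipLetter i)) := by
  induction W with
  | nil => exact (flipHom i).map_one
  | cons l W ih =>
    rw [mk_cons, _root_.map_mul, ih, List.map_cons, mk_cons (flipLetter i l)]
    congr 1
    obtain ⟨j, _ | _⟩ := l <;> by_cases h : j = i <;>
      simp [flipHom, flipLetter, h, of, inv_mk, invRev]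

theorem IsReduced.map_flipLetter (i : ι) {W : List (ι × Bool)} (h : IsReduced W) :
    IsReduced (W.map (flipLetter i)) := by
  refine List.isChain_map_of_isChain _ ?_ h
  rintro ⟨j, a⟩ ⟨k, c⟩ hR hjk
  simp only [flipLetter] at hR hjk ⊢
  subst hjk
  simp [hR rfl]

theorem toWord_flipHom (i : ι) (g : FreeGroup ι) :
    (flipHom i g).toWord = g.toWord.map (flipLetter i) := by
  conv_lhs => rw [← mk_toWord (x := g)]
  rw [flipHom_mk, toWord_mk, (isReduced_toWord.map_flipLetter i).reduce_eq]

theorem mem_closure_of_flipHom_eq {i : ι} {g : FreeGroup ι} (h : flipHom i g = g) :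
    g ∈ Subgroup.closure (of '' {j | j ≠ i}) := by
  rw [← toWord_inj, toWord_flipHom] at h
  rw [← mk_toWord (x := g)]
  refine mk_mem_closure_of fun l hl hli => ?_
  have : ∀ l' ∈ g.toWord, flipLetter i l' = l' := by
    refine List.map_inj_left (g := id) |>.1 ?_
    rw [List.map_id]
    exact h
  have := congrArg Prod.snd (this l hl)
  simp [flipLetter, hli] at this

/-- A word sent by `flipLetter i` to its formal inverse is symmetric. -/
theorem flip_palindrome {i : ι} {a c : ι × Bool} {V : List (ι × Bool)}
    (h : (a :: (V ++ [c])).map (flipLetter i) = invRev (a :: (V ++ [c]))) :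
    mk [c] = (flipHom i (mk [a]))⁻¹ ∧ V.map (flipLetter i) = invRev V ∧
      c = ((flipLetter i a).1, !(flipLetter i a).2) := by
  have h' : flipLetter i a :: (V.map (flipLetter i) ++ [flipLetter i c]) =
      (c.1, !c.2) :: (invRev V ++ [(a.1, !a.2)]) := by
    simpa [invRev] using h
  rw [List.cons.injEq] at h'
  obtain ⟨h1, h2⟩ := h'
  refine ⟨?_, (List.append_inj' h2 rfl).1, by rw [h1]; simp⟩
  rw [flipHom_mk, List.map_singleton, h1]
  simp [inv_mk, invRev]

theorem mk_eq_twisted_conj (i : ι) (n : ℕ) : ∀ W : List (ι × Bool), W.length = n →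
    W.map (flipLetter i) = invRev W →
    ∃ u, mk W = u * (flipHom i u)⁻¹ ∨ mk W = u * of i * (flipHom i u)⁻¹ := by
  induction n using Nat.strong_induction_on with
  | _ n ih =>
    intro W hn hW
    rcases W with _ | ⟨a, W⟩
    · exact ⟨1, Or.inl (by rw [_root_.map_one, inv_one, mul_one, one_eq_mk])⟩
    rcases W.eq_nil_or_concat with rfl | ⟨V, c, rfl⟩
    · obtain ⟨j, e⟩ := a
      have hj : j = i := by
        by_contra hj
        simp [flipLetter, invRev, hj] at hW
      subst hj
      cases e
      · refine ⟨mk [(j, false)], Or.inr ?_⟩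
        rw [mk_letter_false]
        simp [flipHom]
      · exact ⟨1, Or.inr (by simp [of])⟩
    · rw [List.concat_eq_append] at *
      obtain ⟨hc, hV, -⟩ := flip_palindrome hW
      obtain ⟨u, hu⟩ := ih V.length (by simp at hn; omega) V rfl hV
      have hmk : mk (a :: (V ++ [c])) = mk [a] * mk V * (flipHom i (mk [a]))⁻¹ := by
        rw [mk_cons, ← mul_mk, hc, mul_assoc]
      refine ⟨mk [a] * u, ?_⟩
      rw [hmk, _root_.map_mul]
      rcases hu with hu | hu
      · left; rw [hu]; group
      · right; rw [hu]; group

theorem eq_twisted_conj_of_flipHom_eq_inv {i : ι} {g : FreeGroup ι} (h : flipHom i g = g⁻¹) :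
    ∃ u, g = u * (flipHom i u)⁻¹ ∨ g = u * of i * (flipHom i u)⁻¹ := by
  rw [← toWord_inj, toWord_flipHom, toWord_inv] at h
  have := mk_eq_twisted_conj i _ g.toWord rfl h
  rwa [mk_toWord] at this

theorem mk_eq_conj_of_flip_palindrome (i : ι) (n : ℕ) : ∀ W : List (ι × Bool), W.length = n →
    IsReduced W → W.map (flipLetter i) = invRev W →
    ∃ h ∈ Subgroup.closure (of '' {j | j ≠ i}), ∃ V, IsReduced V ∧ mk W = h * mk V * h⁻¹ ∧
      (V = [] ∨ ∃ e, V.head? = some (i, e) ∧ V.getLast? = some (i, e)) := by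
  induction n using Nat.strong_induction_on with
  | _ n ih =>
    intro W hn hr hW
    rcases W with _ | ⟨a, W⟩
    · exact ⟨1, one_mem _, [], hr, by simp, Or.inl rfl⟩
    rcases W.eq_nil_or_concat with rfl | ⟨V, c, rfl⟩
    · obtain ⟨j, e⟩ := a
      have hj : j = i := by
        by_contra hj
        simp [flipLetter, invRev, hj] at hW
      subst hj
      exact ⟨1, one_mem _, _, hr, by simp, Or.inr ⟨e, by simp⟩⟩
    · rw [List.concat_eq_append] at *
      obtain ⟨hc, hV, hc'⟩ := flip_palindrome hW
      by_cases hai : a.1 = i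
      · obtain ⟨j, e⟩ := a
        simp only at hai
        subst hai
        refine ⟨1, one_mem _, _, hr, by simp, Or.inr ⟨e, by simp, ?_⟩⟩
        simp [hc', flipLetter, List.getLast?_cons]
      · have hfa : flipHom i (mk [a]) = mk [a] := by
          simp [flipHom_mk, flipLetter, hai]
        rw [hfa] at hc
        obtain ⟨h, hh, U, hU, hmk, hor⟩ := ih V.length (by simp at hn; omega) V rfl
          (hr.infix ⟨[a], [c], by simp⟩) hV
        have ha : mk [a] ∈ Subgroup.closure (of '' {j | j ≠ i}) :=
          mk_mem_closure_of (by simpa using hai)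
        refine ⟨mk [a] * h, mul_mem ha hh, U, hU, ?_, hor⟩
        rw [mk_cons, ← mul_mk, hc, hmk]
        group

/-- Substituting a word for the generator `i` and its formal inverse, letter by letter. -/
def substLetter (i : ι) (W : List (ι × Bool)) (l : ι × Bool) : List (ι × Bool) :=
  if l.1 = i then (if l.2 then W else invRev W) else [l]

theorem lift_subst_mk (i : ι) (W L : List (ι × Bool)) :
    lift (fun j => if j = i then mk W else of j) (mk L) = mk (L.flatMap (substLetter i W)) := by
  induction L with
  | nil => exact _root_.map_one _
  | cons l L ih =>
    rw [mk_cons, _root_.map_mul, ih, List.flatMap_cons, ← mul_mk]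
    congr 1
    obtain ⟨j, _ | _⟩ := l <;> by_cases h : j = i <;>
      simp [substLetter, h, of, inv_mk, invRev]

theorem substLetter_ends {i : ι} {W : List (ι × Bool)} {e : Bool}
    (hh : W.head? = some (i, e)) (hl : W.getLast? = some (i, e)) (l : ι × Bool) :
    (substLetter i W l).head? = some (if l.1 = i then (i, l.2 == e) else l) ∧
      (substLetter i W l).getLast? = some (if l.1 = i then (i, l.2 == e) else l) := by
  obtain ⟨j, _ | _⟩ := l <;> by_cases h : j = i <;>
    simp [substLetter, h, invRev, hh, hl]

theorem isReduced_flatMap_substLetter {i : ι} {W : List (ι × Bool)} {e : Bool}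
    (hW : IsReduced W) (hh : W.head? = some (i, e)) (hl : W.getLast? = some (i, e))
    {L : List (ι × Bool)} (hL : IsReduced L) : IsReduced (L.flatMap (substLetter i W)) := by
  have hinv : IsReduced (invRev W) := by
    rw [isReduced_iff_reduce_eq, reduce_invRev, hW.reduce_eq]
  have hsub : ∀ l, IsReduced (substLetter i W l) := by
    intro l
    unfold substLetter
    split_ifs
    exacts [hW, hinv, IsReduced.singleton]
  induction L with
  | nil => exact IsReduced.nil
  | cons a L ih =>
    rw [List.flatMap_cons]
    refine List.isChain_append.2 ⟨hsub a, ih (List.IsChain.tail hL), ?_⟩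
    rcases L with _ | ⟨c, L⟩
    · simp
    have hR := (isReduced_cons_cons.1 hL).1
    rw [(substLetter_ends hh hl a).2, List.flatMap_cons, List.head?_append,
      (substLetter_ends hh hl c).1]
    obtain ⟨j, x⟩ := a
    obtain ⟨k, y⟩ := c
    simp only [Option.mem_def, Option.some_or, Option.some.injEq, forall_eq'] at hR ⊢
    split_ifs with h1 h2 h2 <;> grind

theorem eq_generator_of_lift_surjective {i : ι} {W : List (ι × Bool)} (hW : IsReduced W)
    (hends : W = [] ∨ ∃ e, W.head? = some (i, e) ∧ W.getLast? = some (i, e))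
    (hs : Function.Surjective (lift fun j => if j = i then mk W else of j)) :
    mk W = of i ∨ mk W = (of i)⁻¹ := by
  obtain ⟨g, hg⟩ := hs (of i)
  rw [← mk_toWord (x := g), lift_subst_mk] at hg
  rcases hends with rfl | ⟨e, hh, hl⟩
  · exfalso
    have hmem : ∀ l ∈ g.toWord.flatMap (substLetter i []), l.1 ∈ {j | j ≠ i} := by
      intro l hl
      obtain ⟨l', -, hl'⟩ := List.mem_flatMap.1 hl
      unfold substLetter at hl'
      split_ifs at hl' <;> simp_all [invRev]
    have h1 := mk_mem_closure_of hmem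
    rw [hg] at h1
    have h2 : Subgroup.closure (of '' {j | j ≠ i}) ≤
        (lift fun j => if j = i then Multiplicative.ofAdd (1 : ℤ) else 1).ker := by
      rw [Subgroup.closure_le]
      rintro _ ⟨j, hj, rfl⟩
      simpa using hj
    simpa [MonoidHom.mem_ker] using h2 h1
  · have hred := isReduced_flatMap_substLetter hW hh hl (isReduced_toWord (x := g))
    have hlist : g.toWord.flatMap (substLetter i W) = [(i, true)] :=
      eq_of_mk_eq_mk hred IsReduced.singleton hg
    have hne : ∀ l, substLetter i W l ≠ [] := by
      intro l h
      simpa [h] using (substLetter_ends hh hl l).1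
    rcases hg' : g.toWord with _ | ⟨a, L⟩
    · simp [hg'] at hlist
    rw [hg', List.flatMap_cons, List.append_eq_singleton_iff] at hlist
    rcases hlist with ⟨h, -⟩ | ⟨h, -⟩
    · exact absurd h (hne a)
    obtain ⟨j, x⟩ := a
    by_cases hj : j = i
    · cases x
      · right
        simp only [substLetter, hj] at h
        rw [← inv_inj, inv_inv, inv_mk]
        simpa [of] using congrArg mk h
      · left
        simp only [substLetter, hj] at h
        simpa [of] using congrArg mk h
    · simp [substLetter, hj] at h

theorem IsReduced.concat_or {W : List (ι × Bool)} (hW : IsReduced W) (i : ι) :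
    IsReduced (W ++ [(i, true)]) ∨ ∃ U, W = U ++ [(i, false)] := by
  rcases W.eq_nil_or_concat with rfl | ⟨U, ⟨j, e⟩, rfl⟩
  · exact Or.inl IsReduced.singleton
  rw [List.concat_eq_append] at *
  by_cases h : (j, e) = (i, false)
  · exact Or.inr ⟨U, by rw [h]⟩
  · refine Or.inl (List.isChain_append.2 ⟨hW, List.isChain_singleton _, ?_⟩)
    simp only [List.getLast?_append, List.getLast?_singleton, Option.some_or, Option.mem_def,
      Option.some.injEq, List.head?_cons, forall_eq']
    rintro rfl
    cases e <;> simp_all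

theorem eq_one_of_conj_flipHom_eq {i : ι} {g : FreeGroup ι}
    (h : of i * flipHom i g * (of i)⁻¹ = g) : g = 1 := by
  by_contra hg
  rw [mul_inv_eq_iff_eq_mul] at h
  have hr : IsReduced g.toWord := isReduced_toWord
  have hgw : g = mk g.toWord := mk_toWord.symm
  rw [hgw, flipHom_mk] at h
  rcases hw : g.toWord with _ | ⟨a, W⟩
  · exact hg (toWord_eq_nil_iff.1 hw)
  rw [hw] at h hr
  have hfr := hr.map_flipLetter i
  have hright : (∃ U, a :: W = U ++ [(i, false)] ∧ mk (a :: W) * of i = mk U ∧ IsReduced U) ∨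
      (mk (a :: W) * of i = mk (a :: W ++ [(i, true)]) ∧ IsReduced (a :: W ++ [(i, true)])) := by
    rcases hr.concat_or i with h1 | ⟨U, hU⟩
    · exact Or.inr ⟨by rw [← mul_mk]; rfl, h1⟩
    · refine Or.inl ⟨U, hU, ?_, hr.infix ⟨[], [(i, false)], by rw [hU]; simp⟩⟩
      rw [hU, ← mul_mk, mk_letter_false, inv_mul_cancel_right]
  by_cases ha : a = (i, true)
  · have hleft : of i * mk (List.map (flipLetter i) (a :: W)) =
        mk (W.map (flipLetter i)) := by
      rw [List.map_cons, mk_cons, ha]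
      simp [flipLetter, mk_letter_false]
    rw [hleft] at h
    have hfr' : IsReduced (W.map (flipLetter i)) := List.IsChain.tail hfr
    rcases hright with ⟨U, hU, hm, hUr⟩ | ⟨hm, hrr⟩
    · rw [hm] at h
      have hl := eq_of_mk_eq_mk hfr' hUr h
      rcases U with _ | ⟨c, U⟩
      · simp [ha] at hU
      simp only [List.cons_append, List.cons.injEq] at hU
      rcases W with _ | ⟨d, W⟩
      · simp at hl
      simp only [List.map_cons, List.cons.injEq] at hl
      have hd := (isReduced_cons_cons.1 hr).1
      rw [← hU.1, ha] at hl
      have h1 := congrArg Prod.fst hl.1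
      have h2 := congrArg Prod.snd hl.1
      simp only [flipLetter] at h1 h2
      simp only [ha, h1, if_true] at hd h2
      simp [← hd] at h2
    · rw [hm] at h
      have := congrArg List.length (eq_of_mk_eq_mk hfr' hrr h)
      simp at this
      omega
  · have hleft : of i * mk (List.map (flipLetter i) (a :: W)) =
        mk ((i, true) :: List.map (flipLetter i) (a :: W)) := by
      rw [mk_cons (i, true)]; rfl
    have hlr : IsReduced ((i, true) :: List.map (flipLetter i) (a :: W)) := by
      rw [List.map_cons] at hfr ⊢
      refine isReduced_cons_cons.2 ⟨fun hi => ?_, hfr⟩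
      obtain ⟨j, e⟩ := a
      simp only [flipLetter] at hi ⊢
      subst hi
      cases e
      · simp
      · exact absurd rfl ha
    rw [hleft] at h
    rcases hright with ⟨U, hU, hm, hUr⟩ | ⟨hm, hrr⟩
    · rw [hm] at h
      have h1 := congrArg List.length (eq_of_mk_eq_mk hlr hUr h)
      have h2 := congrArg List.length hU
      simp at h1 h2
      omega
    · rw [hm] at h
      have := eq_of_mk_eq_mk hlr hrr h
      simp only [List.cons_append, List.cons.injEq] at this
      exact ha this.1.symm

theorem eq_one_of_forall_commute [Infinite ι] {g : FreeGroup ι}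
    (h : ∀ i, of i * g = g * of i) : g = 1 := by
  rcases hw : g.toWord with _ | ⟨a, W⟩
  · exact toWord_eq_nil_iff.1 hw
  exfalso
  have hr : IsReduced (a :: W) := hw ▸ isReduced_toWord
  obtain ⟨i, hi⟩ := Infinite.exists_notMem_finset
    ({a.1, ((a :: W).getLast (by simp)).1} : Finset ι)
  simp only [Finset.mem_insert, Finset.mem_singleton, not_or] at hi
  have hg : g = mk (a :: W) := by rw [← hw, mk_toWord]
  have h1 : mk ((i, true) :: a :: W) = mk ((a :: W) ++ [(i, true)]) := by
    rw [mk_cons, ← mul_mk, ← hg]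
    exact h i
  have h2 := eq_of_mk_eq_mk (isReduced_cons_cons.2 ⟨fun h => absurd h hi.1, hr⟩)
    (List.isChain_append.2 ⟨hr, List.isChain_singleton _, by
      intro x hx y hy hxy
      simp only [List.head?_cons, Option.mem_def, Option.some.injEq] at hy
      rw [List.getLast?_eq_some_getLast (by simp)] at hx
      simp only [Option.mem_def, Option.some.injEq] at hx
      subst hy hx
      exact absurd hxy.symm hi.2⟩) h1
  simp only [List.cons_append, List.cons.injEq] at h2
  exact hi.1 (congrArg Prod.fst h2.1)

end FreeGroup

namespace FreeGroupBasis

variable {ι G : Type*} [Group G]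

/-- The subgroup generated by all elements of a basis other than `b i`. -/
def complement (b : FreeGroupBasis ι G) (i : ι) : Subgroup G :=
  Subgroup.closure (b '' {j | j ≠ i})

/-- `φ` inverts the basis element `b i` and fixes all other elements of the basis `b`. -/
def IsFlip (b : FreeGroupBasis ι G) (i : ι) (φ : MulAut G) : Prop :=
  φ (b i) = (b i)⁻¹ ∧ ∀ j, j ≠ i → φ (b j) = b j

theorem lift_basis {H : Type*} [Group H] (b : FreeGroupBasis ι G) (f : ι → H) (i : ι) :
    b.lift f (b i) = f i := by
  simp

theorem basis_ne_one (b : FreeGroupBasis ι G) (i : ι) : b i ≠ 1 := fun h =>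
  FreeGroup.of_ne_one i (by rw [← b.repr_apply_coe i, h, map_one])

theorem mem_of_forall (b : FreeGroupBasis ι G) {S : Subgroup G} (h : ∀ i, b i ∈ S) (g : G) :
    g ∈ S := by
  have : S.subtype.comp (b.lift fun i => (⟨b i, h i⟩ : S)) = MonoidHom.id G :=
    b.ext_hom _ _ fun i => by simp
  have hg : S.subtype (b.lift (fun i => (⟨b i, h i⟩ : S)) g) = g := DFunLike.congr_fun this g
  rw [← hg]
  exact Subtype.prop _

theorem mem_of_complement (b : FreeGroupBasis ι G) {S : Subgroup G} (i : ι) (hi : b i ∈ S)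
    (h : b.complement i ≤ S) (g : G) : g ∈ S := by
  refine b.mem_of_forall (fun j => ?_) g
  by_cases hj : j = i
  · rwa [hj]
  · exact h (Subgroup.subset_closure ⟨j, hj, rfl⟩)

theorem basis_mem_complement (b : FreeGroupBasis ι G) {i j : ι} (h : j ≠ i) :
    b j ∈ b.complement i :=
  Subgroup.subset_closure ⟨j, h, rfl⟩

theorem map_repr_symm_closure (b : FreeGroupBasis ι G) {i : ι} {g : FreeGroup ι}
    (hg : g ∈ Subgroup.closure (FreeGroup.of '' {j | j ≠ i})) :
    b.repr.symm g ∈ b.complement i := by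
  have h := Subgroup.mem_map_of_mem b.repr.symm.toMonoidHom hg
  rw [MonoidHom.map_closure, Set.image_image] at h
  exact h

theorem eqOn_complement {H : Type*} [Group H] (b : FreeGroupBasis ι G) {i : ι} {f k : G →* H}
    (h : ∀ j, j ≠ i → f (b j) = k (b j)) {g : G} (hg : g ∈ b.complement i) : f g = k g := by
  have : b.complement i ≤ MonoidHom.eqLocus f k := by
    rw [complement, Subgroup.closure_le]
    rintro _ ⟨j, hj, rfl⟩
    exact h j hj
  exact this hg

theorem eq_of_eqOn_complement {H : Type*} [Group H] (b : FreeGroupBasis ι G) {i : ι}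
    {f k : G →* H} (hi : f (b i) = k (b i)) (h : ∀ g ∈ b.complement i, f g = k g) (g : G) :
    f g = k g :=
  b.mem_of_complement (S := MonoidHom.eqLocus f k) i hi h g

theorem eq_one_of_conj_eq_one [Infinite ι] (b : FreeGroupBasis ι G) {g : G}
    (h : MulAut.conj g = 1) : g = 1 := by
  classical
  have : b.repr g = 1 := by
    refine FreeGroup.eq_one_of_forall_commute fun i => ?_
    rw [← b.repr_apply_coe i, ← map_mul, ← map_mul]
    congr 1
    have := DFunLike.congr_fun h (b i)
    rw [MulAut.conj_apply, MulAut.one_apply, mul_inv_eq_iff_eq_mul] at this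
    exact this.symm
  simpa using this

theorem conj_injective [Infinite ι] (b : FreeGroupBasis ι G) :
    Function.Injective (MulAut.conj : G →* MulAut G) :=
  (injective_iff_map_eq_one _).2 fun _ => b.eq_one_of_conj_eq_one

theorem mulAut_mul_conj (φ : MulAut G) (g : G) :
    φ * MulAut.conj g = MulAut.conj (φ g) * φ := by
  ext x
  simp

namespace IsFlip

variable {b : FreeGroupBasis ι G} {i : ι} {ψ : MulAut G}

theorem repr_apply [DecidableEq ι] (hψ : b.IsFlip i ψ) (g : G) :
    b.repr (ψ g) = FreeGroup.flipHom i (b.repr g) := by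
  have : b.repr.toMonoidHom.comp ψ.toMonoidHom =
      (FreeGroup.flipHom i).comp b.repr.toMonoidHom := by
    refine b.ext_hom _ _ fun j => ?_
    by_cases hj : j = i
    · subst hj
      simp [hψ.1, FreeGroup.flipHom]
    · simp [hψ.2 j hj, FreeGroup.flipHom, hj]
  exact DFunLike.congr_fun this g

theorem apply_eq_of_mem (hψ : b.IsFlip i ψ) {g : G} (hg : g ∈ b.complement i) : ψ g = g :=
  b.eqOn_complement (f := ψ.toMonoidHom) (k := MonoidHom.id G) hψ.2 hg

theorem mem_complement (hψ : b.IsFlip i ψ) {g : G} (hg : ψ g = g) : g ∈ b.complement i := by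
  classical
  have := FreeGroup.mem_closure_of_flipHom_eq (i := i) (g := b.repr g)
    (by rw [← hψ.repr_apply, hg])
  simpa using b.map_repr_symm_closure this

theorem mul_self (hψ : b.IsFlip i ψ) : ψ * ψ = 1 := by
  have : ψ.toMonoidHom.comp ψ.toMonoidHom = MonoidHom.id G := by
    refine b.ext_hom _ _ fun j => ?_
    by_cases hj : j = i
    · subst hj
      simp [hψ.1]
    · simp [hψ.2 j hj]
  ext g
  exact DFunLike.congr_fun this g

theorem conj (hψ : b.IsFlip i ψ) (α : MulAut G) : (b.map α).IsFlip i (α * ψ * α⁻¹) := by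
  refine ⟨?_, fun j hj => ?_⟩
  · simp [hψ.1]
  · simp [hψ.2 j hj]

theorem eq_twisted_conj (hψ : b.IsFlip i ψ) {g : G} (hg : ψ g = g⁻¹) :
    ∃ u, g = u * (ψ u)⁻¹ ∨ g = u * b i * (ψ u)⁻¹ := by
  classical
  obtain ⟨u, hu⟩ := FreeGroup.eq_twisted_conj_of_flipHom_eq_inv (i := i) (g := b.repr g)
    (by rw [← hψ.repr_apply, hg, map_inv])
  obtain ⟨v, rfl⟩ := b.repr.surjective u
  refine ⟨v, ?_⟩
  rw [← hψ.repr_apply, ← b.repr_apply_coe i] at hu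
  simpa only [← map_inv, ← map_mul, EmbeddingLike.apply_eq_iff_eq] using hu

theorem eq_one_of_conj_eq (hψ : b.IsFlip i ψ) {g : G} (hg : b i * ψ g * (b i)⁻¹ = g) :
    g = 1 := by
  classical
  have : b.repr g = 1 := by
    refine FreeGroup.eq_one_of_conj_flipHom_eq (i := i) ?_
    rw [← hψ.repr_apply, ← b.repr_apply_coe i, ← map_inv, ← map_mul, ← map_mul, hg]
  simpa using this

/-- An automorphism commuting with a flip at `b i` maps `b i` to a conjugate of `b i` or its
inverse. -/
theorem apply_basis_of_commute (hψ : b.IsFlip i ψ) {α : MulAut G} (hα : α * ψ = ψ * α) :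
    ∃ h ∈ b.complement i, α (b i) = h * b i * h⁻¹ ∨ α (b i) = h * (b i)⁻¹ * h⁻¹ := by
  classical
  have hcomm : ∀ g, ψ (α g) = α (ψ g) := fun g => (DFunLike.congr_fun hα g).symm
  have hinv : FreeGroup.flipHom i (b.repr (α (b i))) = (b.repr (α (b i)))⁻¹ := by
    rw [← hψ.repr_apply, hcomm, hψ.1, map_inv, map_inv]
  rw [← FreeGroup.toWord_inj, FreeGroup.toWord_flipHom, FreeGroup.toWord_inv] at hinv
  obtain ⟨h, hh, V, hV, hmk, hends⟩ := FreeGroup.mk_eq_conj_of_flip_palindrome i _ _ rfl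
    FreeGroup.isReduced_toWord hinv
  rw [FreeGroup.mk_toWord] at hmk
  have hhc := b.map_repr_symm_closure hh
  have hαz : α (b i) = b.repr.symm h * b.repr.symm (FreeGroup.mk V) * (b.repr.symm h)⁻¹ := by
    rw [← map_inv, ← map_mul, ← map_mul, ← hmk, MulEquiv.symm_apply_apply]
  set θ := FreeGroup.lift (fun j => if j = i then FreeGroup.mk V else FreeGroup.of j) with hθ
  let S : Subgroup G := θ.range.comap b.repr.toMonoidHom
  have hcS : b.complement i ≤ S := by
    rw [complement, Subgroup.closure_le]
    rintro _ ⟨j, hj, rfl⟩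
    refine ⟨FreeGroup.of j, ?_⟩
    have hj' : j ≠ i := hj
    simp [θ, hj']
  have hVS : b.repr.symm (FreeGroup.mk V) ∈ S := ⟨FreeGroup.of i, by simp [θ]⟩
  have hS : ∀ g, g ∈ S.comap α.toMonoidHom := by
    refine b.mem_of_complement i ?_ ?_
    · change α (b i) ∈ S
      rw [hαz]
      exact mul_mem (mul_mem (hcS hhc) hVS) (inv_mem (hcS hhc))
    · intro g hg
      exact hcS (hψ.mem_complement (by
        change ψ (α g) = α g
        rw [hcomm, hψ.apply_eq_of_mem hg]))
  have hsurj : Function.Surjective θ := by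
    intro g
    have := hS (α.symm (b.repr.symm g))
    simpa [S] using this
  refine ⟨b.repr.symm h, hhc, ?_⟩
  rw [hαz]
  rcases FreeGroup.eq_generator_of_lift_surjective hV hends hsurj with h1 | h1
  · left; rw [h1]; rfl
  · right; rw [h1, map_inv]; rfl

/-- The involutions in the coset of inner automorphisms of a flip fall into two classes. -/
theorem conj_mul_involution [Infinite ι] (hψ : b.IsFlip i ψ) {w : G}
    (h : (MulAut.conj w * ψ) * (MulAut.conj w * ψ) = 1) :
    ∃ u, MulAut.conj w * ψ = MulAut.conj u * ψ * (MulAut.conj u)⁻¹ ∨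
      MulAut.conj w * ψ = MulAut.conj u * (MulAut.conj (b i) * ψ) * (MulAut.conj u)⁻¹ := by
  have h1 : MulAut.conj (w * ψ w) = 1 := by
    rw [← h, mul_assoc (MulAut.conj w), ← mul_assoc ψ, mulAut_mul_conj, mul_assoc _ ψ,
      hψ.mul_self, mul_one, map_mul]
  have h2 := b.eq_one_of_conj_eq_one h1
  have hψu : ∀ u, (MulAut.conj (ψ u))⁻¹ * ψ = ψ * (MulAut.conj u)⁻¹ := by
    intro u
    rw [inv_mul_eq_iff_eq_mul, ← mul_assoc, ← mulAut_mul_conj, mul_inv_cancel_right]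
  obtain ⟨u, hu | hu⟩ := hψ.eq_twisted_conj (eq_inv_of_mul_eq_one_right h2)
  · refine ⟨u, Or.inl ?_⟩
    rw [hu, map_mul, map_inv, mul_assoc, hψu, mul_assoc]
  · refine ⟨u, Or.inr ?_⟩
    rw [hu, map_mul, map_mul, map_inv, mul_assoc, hψu]
    simp only [mul_assoc]

end IsFlip

end FreeGroupBasis

namespace FreeGroupBasis

/-- `φ` inverts two elements of the basis `b` and fixes all the others. -/
def IsDoubleFlip {ι G : Type*} [Group G] (b : FreeGroupBasis ι G) (i j : ι) (φ : MulAut G) :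
    Prop :=
  φ (b i) = (b i)⁻¹ ∧ φ (b j) = (b j)⁻¹ ∧ ∀ k, k ≠ i → k ≠ j → φ (b k) = b k

variable {ι G : Type*} [Group G] {b b₁ : FreeGroupBasis ι G} {i i₁ : ι} {φ ψ : MulAut G}

/-- A flip inverting `b i` and preserving the complement of `b i` fixes that complement. -/
theorem IsFlip.apply_eq_of_inverts [Infinite ι] (hφ : b₁.IsFlip i₁ φ)
    (hz : φ (b i) = (b i)⁻¹) (hH : ∀ g ∈ b.complement i, φ g ∈ b.complement i) {g : G}
    (hg : g ∈ b.complement i) : φ g = g := by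
  classical
  let ρ : G →* MulAut G := b.lift fun j => if j = i then φ else MulAut.conj (b j)
  have hρz : ρ (b i) = φ := by rw [lift_basis, if_pos rfl]
  have hρH : ∀ g ∈ b.complement i, ρ g = MulAut.conj g := fun g hg =>
    b.eqOn_complement (fun j hj => by rw [lift_basis, if_neg hj]) hg
  have hφinv : φ⁻¹ = φ := inv_eq_of_mul_eq_one_left hφ.mul_self
  have hρφ : ∀ g, ρ (φ g) = φ * ρ g * φ⁻¹ := by
    refine b.eq_of_eqOn_complement (f := ρ.comp φ.toMonoidHom)
      (k := (MulAut.conj φ).toMonoidHom.comp ρ) (i := i) ?_ fun g hg => ?_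
    · change ρ (φ (b i)) = φ * ρ (b i) * φ⁻¹
      rw [hz, map_inv, hρz, mul_inv_cancel_right, hφinv]
    · change ρ (φ g) = φ * ρ g * φ⁻¹
      rw [hρH _ (hH g hg), hρH g hg, mulAut_mul_conj, mul_inv_cancel_right]
  have hx : ρ (b₁ i₁) = φ := by
    obtain ⟨u, hu | hu⟩ := hφ.eq_twisted_conj hz
    · have h1 := congrArg ρ hu
      rw [map_mul, map_inv, hρφ, hρz] at h1
      have h2 : φ = 1 := by
        have : ρ u * φ * (ρ u)⁻¹ = 1 := by
          rw [← hφ.mul_self]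
          nth_rewrite 2 [h1]
          rw [hφinv]
          simp only [mul_inv_rev, hφinv, mul_assoc, hφ.mul_self, mul_one]
        simpa [mul_inv_eq_one] using this
      have hxx := hφ.1
      rw [h2, MulAut.one_apply] at hxx
      exfalso
      have hk := congrArg (b₁.lift fun _ => Multiplicative.ofAdd (1 : ℤ)) hxx
      rw [map_inv, lift_basis] at hk
      exact absurd (congrArg Multiplicative.toAdd hk) (by simp)
    · have h1 := congrArg ρ hu
      rw [map_mul, map_mul, map_inv, hρφ, hρz, hφinv] at h1
      have : ρ u * (ρ (b₁ i₁) * φ) * (ρ u)⁻¹ = 1 := by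
        rw [← hφ.mul_self]
        nth_rewrite 2 [h1]
        simp only [mul_inv_rev, hφinv, mul_assoc, hφ.mul_self, mul_one]
      rw [mul_inv_eq_one, mul_eq_left, mul_eq_one_iff_eq_inv, hφinv] at this
      exact this
  have hcomm : ∀ g, g ∈ (Subgroup.centralizer {φ}).comap ρ := by
    refine b₁.mem_of_complement i₁ ?_ fun l hl => ?_
    · rw [Subgroup.mem_comap, hx, Subgroup.mem_centralizer_singleton_iff]
    · rw [Subgroup.mem_comap, Subgroup.mem_centralizer_singleton_iff]
      have := hρφ l
      rw [hφ.apply_eq_of_mem hl, eq_mul_inv_iff_mul_eq] at this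
      exact this
  have h := hcomm g
  rw [Subgroup.mem_comap, hρH g hg, Subgroup.mem_centralizer_singleton_iff,
    mulAut_mul_conj] at h
  exact (b.conj_injective (mul_right_cancel h)).symm

/-- The inclusion of the rotations of the triangle. -/
def rotationHom : Multiplicative (ZMod 3) →* DihedralGroup 3 where
  toFun k := DihedralGroup.r k.toAdd
  map_one' := rfl
  map_mul' _ _ := by simp

theorem dihedral_eq_one_of_commute : ∀ (q : DihedralGroup 3) (k : ZMod 3), k ≠ 0 →
    q * DihedralGroup.sr 0 = DihedralGroup.sr 0 * q →
    q * DihedralGroup.r k = DihedralGroup.r k * q → q = 1 := by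
  decide

/-- The twist of a flip by the inverted basis element cannot invert another basis element while
preserving the complement. -/
theorem IsFlip.conj_mul_not_inverts [Infinite ι] (hφ : b₁.IsFlip i₁ φ)
    (hz : (MulAut.conj (b₁ i₁) * φ) (b i) = (b i)⁻¹)
    (hH : ∀ g ∈ b.complement i, (MulAut.conj (b₁ i₁) * φ) g ∈ b.complement i) : False := by
  classical
  obtain ⟨j₁, hj₁⟩ := exists_ne i₁
  set α := MulAut.conj (b₁ i₁) * φ with hα
  have hαg : ∀ g, α g = b₁ i₁ * φ g * (b₁ i₁)⁻¹ := fun g => rfl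
  let χ : G →* Multiplicative (ZMod 3) :=
    b₁.lift fun j => if j = j₁ then Multiplicative.ofAdd 1 else 1
  have hχφ : ∀ g, χ (φ g) = χ g := by
    refine b₁.eq_of_eqOn_complement (f := χ.comp φ.toMonoidHom) (k := χ) (i := i₁) ?_
      fun g hg => ?_
    · change χ (φ (b₁ i₁)) = χ (b₁ i₁)
      rw [hφ.1, map_inv, lift_basis, if_neg hj₁.symm, inv_one]
    · change χ (φ g) = χ g
      rw [hφ.apply_eq_of_mem hg]
  have hχα : ∀ g, χ (α g) = χ g := fun g => by
    rw [hαg, map_mul, map_mul, map_inv, mul_inv_cancel_comm, hχφ]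
  have hχz : χ (b i) = 1 := by
    have h := hχα (b i)
    rw [hz, map_inv] at h
    revert h
    generalize χ (b i) = k
    revert k
    decide
  obtain ⟨j, hji, hj⟩ : ∃ j, j ≠ i ∧ χ (b j) ≠ 1 := by
    by_contra! hcon
    have h1 : χ (b₁ j₁) = 1 := by
      refine b.mem_of_forall (S := χ.ker) (fun j => ?_) _
      by_cases hj : j = i
      · rw [hj]; exact hχz
      · exact hcon j hj
    rw [lift_basis, if_pos rfl] at h1
    exact absurd h1 (by decide)
  let ρ : G →* DihedralGroup 3 :=
    b.lift fun j => if j = i then DihedralGroup.sr 0 else rotationHom (χ (b j))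
  have hρz : ρ (b i) = DihedralGroup.sr 0 := by rw [lift_basis, if_pos rfl]
  have hρH : ∀ g ∈ b.complement i, ρ g = rotationHom (χ g) := fun g hg =>
    b.eqOn_complement (k := rotationHom.comp χ)
      (fun j hj => by rw [lift_basis, if_neg hj]; rfl) hg
  have hρα : ∀ g, ρ (α g) = ρ g := by
    refine b.eq_of_eqOn_complement (f := ρ.comp α.toMonoidHom) (k := ρ) (i := i) ?_
      fun g hg => ?_
    · change ρ (α (b i)) = ρ (b i)
      rw [hz, map_inv, hρz]
      rfl
    · change ρ (α g) = ρ g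
      rw [hρH _ (hH g hg), hρH g hg, hχα]
  have hcomm : ∀ g, g ∈ (Subgroup.centralizer {ρ (b₁ i₁)}).comap ρ := by
    refine b₁.mem_of_complement i₁ ?_ fun l hl => ?_
    · rw [Subgroup.mem_comap, Subgroup.mem_centralizer_singleton_iff]
    · rw [Subgroup.mem_comap, Subgroup.mem_centralizer_singleton_iff]
      have := hρα l
      rw [hαg, hφ.apply_eq_of_mem hl, map_mul, map_mul, map_inv, mul_inv_eq_iff_eq_mul] at this
      exact this.symm
  have hρx : ρ (b₁ i₁) = 1 := by
    refine dihedral_eq_one_of_commute _ (χ (b j)).toAdd hj ?_ ?_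
    · have := hcomm (b i)
      rw [Subgroup.mem_comap, Subgroup.mem_centralizer_singleton_iff, hρz] at this
      exact this.symm
    · have := hcomm (b j)
      rw [Subgroup.mem_comap, Subgroup.mem_centralizer_singleton_iff,
        hρH _ (b.basis_mem_complement hji)] at this
      exact this.symm
  have hρφ : ∀ g, ρ (φ g) = ρ g := fun g => by
    have := hρα g
    rwa [hαg, map_mul, map_mul, map_inv, hρx, one_mul, inv_one, mul_one] at this
  have hm : φ (b i * b₁ i₁) = (b i * b₁ i₁)⁻¹ := by
    rw [hαg, mul_inv_eq_iff_eq_mul] at hz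
    rw [map_mul, hφ.1, mul_inv_rev, ← mul_right_inj (b₁ i₁), ← mul_assoc, hz]
    group
  have hρm : ρ (b i * b₁ i₁) = 1 := by
    obtain ⟨u, hu | hu⟩ := hφ.eq_twisted_conj hm
    · rw [hu, map_mul, map_inv, hρφ, mul_inv_cancel]
    · rw [hu, map_mul, map_mul, map_inv, hρφ, hρx, mul_one, mul_inv_cancel]
  rw [map_mul, hρx, hρz, mul_one] at hρm
  exact absurd hρm (by decide)

end FreeGroupBasis

namespace FreeGroupBasis

universe u

variable {ι : Type*} {G : Type u} [Group G] {b b₁ : FreeGroupBasis ι G} {i i₁ : ι}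
  {φ ψ : MulAut G}

/-- If a flip fixes `b i` and preserves the complement of `b i`, then its product with a flip at
`b i` is a double flip. -/
theorem IsFlip.exists_isDoubleFlip_of_fixes (hφ : b₁.IsFlip i₁ φ) (hψ : b.IsFlip i ψ)
    (hz : φ (b i) = b i) (hH : ∀ g ∈ b.complement i, φ g ∈ b.complement i) :
    ∃ (J : Type u) (c : FreeGroupBasis (Option (Option J)) G),
      c.IsDoubleFlip none (some none) (φ * ψ) := by
  classical
  have := b.isFreeGroup
  let π : G →* G := b.lift fun j => if j = i then 1 else b j
  have hπz : π (b i) = 1 := by rw [lift_basis, if_pos rfl]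
  have hπH : ∀ g ∈ b.complement i, π g = g := fun g hg =>
    b.eqOn_complement (k := MonoidHom.id G)
      (fun j hj => by rw [lift_basis, if_neg hj]; rfl) hg
  have hπmem : ∀ g, π g ∈ b.complement i := by
    refine b.mem_of_complement (S := (b.complement i).comap π) i ?_ fun g hg => ?_
    · rw [Subgroup.mem_comap, hπz]; exact one_mem _
    · rw [Subgroup.mem_comap, hπH g hg]; exact hg
  have hπφ : ∀ g, π (φ g) = φ (π g) := by
    refine b.eq_of_eqOn_complement (f := π.comp φ.toMonoidHom)
      (k := φ.toMonoidHom.comp π) (i := i) ?_ fun g hg => ?_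
    · change π (φ (b i)) = φ (π (b i))
      rw [hz, hπz, map_one]
    · change π (φ g) = φ (π g)
      rw [hπH _ (hH g hg), hπH g hg]
  let L := b₁.complement i₁
  let M := L.map π
  let m := IsFreeGroup.basis M
  let κ : L →* FreeGroup (Option (IsFreeGroup.Generators M)) :=
    (FreeGroup.map some).comp (m.repr.toMonoidHom.comp (π.subgroupMap L))
  let Λ : G →* FreeGroup (Option (IsFreeGroup.Generators M)) :=
    b₁.lift fun j => if hj : j = i₁ then FreeGroup.of none
      else κ ⟨b₁ j, b₁.basis_mem_complement hj⟩
  have hΛx : Λ (b₁ i₁) = FreeGroup.of none := by rw [lift_basis, dif_pos rfl]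
  have hΛL : ∀ (l : G) (hl : l ∈ L), Λ l = κ ⟨l, hl⟩ := by
    intro l hl
    induction hl using Subgroup.closure_induction with
    | mem g hg =>
      obtain ⟨j, hj, rfl⟩ := hg
      have hj' : j ≠ i₁ := hj
      rw [lift_basis, dif_neg hj']
    | one => rw [map_one]; exact (map_one κ).symm
    | mul g h hg hh ihg ihh => rw [map_mul, ihg, ihh, ← map_mul]; rfl
    | inv g hg ih => rw [map_inv, ih, ← map_inv]; rfl
  let μ : FreeGroup (Option (IsFreeGroup.Generators M)) →* G :=
    FreeGroup.lift fun o => o.elim (π (b₁ i₁)) fun j => (m j : G)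
  have hμmap : ∀ p, μ (FreeGroup.map some p) = (m.repr.symm p : M) := by
    have : μ.comp (FreeGroup.map some) = M.subtype.comp m.repr.symm.toMonoidHom := by
      refine FreeGroup.ext_hom _ _ fun j => ?_
      simp [μ]
      rfl
    exact fun p => DFunLike.congr_fun this p
  have hμΛ : ∀ g, μ (Λ g) = π g := by
    refine b₁.eq_of_eqOn_complement (f := μ.comp Λ) (k := π) (i := i₁) ?_ fun l hl => ?_
    · change μ (Λ (b₁ i₁)) = _
      rw [hΛx]
      simp [μ]
    · change μ (Λ l) = _
      rw [hΛL l hl]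
      change μ (FreeGroup.map some (m.repr (π.subgroupMap L ⟨l, hl⟩))) = _
      rw [hμmap, MulEquiv.symm_apply_apply]
      rfl
  have hΛz : Λ (b i) = 1 := by
    have hzL : b i ∈ L := hφ.mem_complement hz
    rw [hΛL _ hzL]
    have : π.subgroupMap L ⟨b i, hzL⟩ = 1 := Subtype.ext hπz
    change FreeGroup.map some (m.repr (π.subgroupMap L ⟨b i, hzL⟩)) = 1
    rw [this, map_one, map_one]
  have hΛπ : ∀ g, Λ (π g) = Λ g := by
    refine b.eq_of_eqOn_complement (f := Λ.comp π) (k := Λ) (i := i) ?_ fun g hg => ?_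
    · change Λ (π (b i)) = _
      rw [hπz, hΛz, map_one]
    · change Λ (π g) = _
      rw [hπH g hg]
  have hΛμ : ∀ p, Λ (μ p) = p := by
    have : Λ.comp μ = MonoidHom.id _ := by
      refine FreeGroup.ext_hom _ _ fun o => ?_
      rcases o with _ | j
      · change Λ (μ _) = FreeGroup.of none
        simp only [μ, FreeGroup.lift_apply_of, Option.elim]
        rw [hΛπ, hΛx]
      · change Λ (μ _) = FreeGroup.of (some j)
        simp only [μ, FreeGroup.lift_apply_of, Option.elim]
        obtain ⟨l, hl, hlj⟩ := (m j).2
        rw [← hlj, hΛπ, hΛL l hl]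
        change FreeGroup.map some (m.repr (π.subgroupMap L ⟨l, hl⟩)) = _
        have : π.subgroupMap L ⟨l, hl⟩ = m j := Subtype.ext hlj
        rw [this, m.repr_apply_coe, FreeGroup.map.of]
    exact fun p => DFunLike.congr_fun this p
  have hμmem : ∀ p, μ p ∈ b.complement i := fun p => by
    rw [← hΛμ p, hμΛ]
    exact hπmem _
  let Θ : FreeGroup (Option (Option (IsFreeGroup.Generators M))) →* G :=
    FreeGroup.lift fun o => o.elim (b i) fun o' => μ (FreeGroup.of o')
  let Ξ : G →* FreeGroup (Option (Option (IsFreeGroup.Generators M))) :=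
    b.lift fun j => if j = i then FreeGroup.of none else FreeGroup.map some (Λ (b j))
  have hΘmap : ∀ p, Θ (FreeGroup.map some p) = μ p := by
    have : Θ.comp (FreeGroup.map some) = μ :=
      FreeGroup.ext_hom _ _ fun j => by simp [Θ]
    exact fun p => DFunLike.congr_fun this p
  have hΞH : ∀ g ∈ b.complement i, Ξ g = FreeGroup.map some (Λ g) := fun g hg =>
    b.eqOn_complement (k := (FreeGroup.map some).comp Λ)
      (fun j hj => by rw [lift_basis, if_neg hj]; rfl) hg
  have hΞz : Ξ (b i) = FreeGroup.of none := by rw [lift_basis, if_pos rfl]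
  have hΘΞ : Θ.comp Ξ = MonoidHom.id G := by
    ext g
    refine b.eq_of_eqOn_complement (f := Θ.comp Ξ) (k := MonoidHom.id G) (i := i) ?_
      (fun g hg => ?_) g
    · change Θ (Ξ (b i)) = b i
      rw [hΞz]
      simp [Θ]
    · change Θ (Ξ g) = g
      rw [hΞH g hg, hΘmap, hμΛ, hπH g hg]
  have hΞΘ : Ξ.comp Θ = MonoidHom.id _ := by
    refine FreeGroup.ext_hom _ _ fun o => ?_
    rcases o with _ | o
    · change Ξ (Θ _) = FreeGroup.of none
      simp only [Θ, FreeGroup.lift_apply_of, Option.elim]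
      exact hΞz
    · change Ξ (Θ _) = FreeGroup.of (some o)
      simp only [Θ, FreeGroup.lift_apply_of, Option.elim]
      rw [hΞH _ (hμmem _), hΛμ, FreeGroup.map.of]
  have hfix : ∀ g, (φ * ψ) (π g) = π (φ g) := fun g => by
    rw [MulAut.mul_apply, hψ.apply_eq_of_mem (hπmem g), hπφ]
  let c : FreeGroupBasis (Option (Option (IsFreeGroup.Generators M))) G :=
    ofRepr (MonoidHom.toMulEquiv Ξ Θ hΘΞ hΞΘ)
  have hc : ∀ o, c o = Θ (FreeGroup.of o) := fun o => rfl
  refine ⟨_, c, ?_, ?_, ?_⟩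
  · rw [hc]
    simp only [Θ, FreeGroup.lift_apply_of, Option.elim]
    rw [MulAut.mul_apply, hψ.1, map_inv, hz]
  · rw [hc]
    simp only [Θ, μ, FreeGroup.lift_apply_of, Option.elim]
    rw [hfix, hφ.1, map_inv]
  · rintro (_ | _ | j) h1 h2
    · exact absurd rfl h1
    · exact absurd rfl h2
    · rw [hc]
      simp only [Θ, μ, FreeGroup.lift_apply_of, Option.elim]
      obtain ⟨l, hl, hlj⟩ := (m j).2
      rw [← hlj, hfix, hφ.apply_eq_of_mem hl]

/-- The involutions in the coset of inner automorphisms of a flip are flips or twisted flips. -/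
theorem IsFlip.isFlip_or_twisted [Infinite ι] (hφ : b₁.IsFlip i₁ φ) {t : G}
    (h : (MulAut.conj t * φ) * (MulAut.conj t * φ) = 1) :
    ∃ c : FreeGroupBasis ι G, c.IsFlip i₁ (MulAut.conj t * φ) ∨
      ∃ φ', c.IsFlip i₁ φ' ∧ MulAut.conj t * φ = MulAut.conj (c i₁) * φ' := by
  obtain ⟨u, hu | hu⟩ := hφ.conj_mul_involution h
  · exact ⟨b₁.map (MulAut.conj u), Or.inl (hu ▸ hφ.conj (MulAut.conj u))⟩
  · refine ⟨b₁.map (MulAut.conj u), Or.inr ⟨_, hφ.conj (MulAut.conj u), ?_⟩⟩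
    rw [hu, map_apply, ← mul_assoc, mulAut_mul_conj]
    simp only [mul_assoc]

/-- If the product of two flips is an outer involution, then modulo inner automorphisms it is a
double flip. -/
theorem IsFlip.exists_isDoubleFlip [Infinite ι] (hφ : b₁.IsFlip i₁ φ) (hψ : b.IsFlip i ψ)
    {w : G} (hw : φ * ψ * (φ * ψ) = MulAut.conj w) (hne : ∀ v, φ * ψ ≠ MulAut.conj v) :
    ∃ (J : Type u) (c : FreeGroupBasis (Option (Option J)) G) (t : G),
      c.IsDoubleFlip none (some none) (MulAut.conj t * (φ * ψ)) := by
  have hφinv : φ⁻¹ = φ := inv_eq_of_mul_eq_one_left hφ.mul_self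
  have hconj : φ * ψ * φ⁻¹ = MulAut.conj w * ψ := by
    rw [← hw, hφinv]
    simp only [mul_assoc, hψ.mul_self, mul_one]
  obtain ⟨u, hu⟩ : ∃ u, φ * ψ * φ⁻¹ = MulAut.conj u * ψ * (MulAut.conj u)⁻¹ := by
    have hinv : (MulAut.conj w * ψ) * (MulAut.conj w * ψ) = 1 := by
      rw [← hconj]
      simp only [mul_assoc, inv_mul_cancel_left]
      rw [← mul_assoc ψ, hψ.mul_self, one_mul, mul_inv_cancel]
    obtain ⟨u, hu | hu⟩ := hψ.conj_mul_involution hinv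
    · exact ⟨u, hconj.trans hu⟩
    · exfalso
      obtain ⟨j, hj⟩ := exists_ne i
      rw [← hconj] at hu
      have h1 := DFunLike.congr_fun hu (φ (b j))
      have h2 : (φ * ψ * φ⁻¹) (φ (b j)) = φ (b j) := by
        simp [hψ.2 j hj]
      rw [h2] at h1
      have h3 : (MulAut.conj u)⁻¹ (φ (b j)) = 1 := by
        refine hψ.eq_one_of_conj_eq ?_
        conv_rhs => rw [h1]
        simp [mul_assoc]
      rw [map_eq_one_iff _ (MulEquiv.injective _), map_eq_one_iff _ (MulEquiv.injective _)] at h3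
      exact b.basis_ne_one j h3
  have hφ'ψ : ((MulAut.conj u)⁻¹ * φ) * ψ = ψ * ((MulAut.conj u)⁻¹ * φ) := by
    rw [mul_inv_eq_iff_eq_mul] at hu
    rw [mul_assoc, hu]
    simp only [mul_assoc, inv_mul_cancel_left]
  obtain ⟨h, hh, hhz⟩ := hψ.apply_basis_of_commute hφ'ψ
  have hhψ : (MulAut.conj h)⁻¹ * ψ = ψ * (MulAut.conj h)⁻¹ := by
    rw [inv_mul_eq_iff_eq_mul, ← mul_assoc, eq_mul_inv_iff_mul_eq, mulAut_mul_conj,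
      hψ.apply_eq_of_mem hh]
  obtain ⟨t, ht⟩ : ∃ t, t = h⁻¹ * u⁻¹ := ⟨_, rfl⟩
  obtain ⟨α, hα⟩ : ∃ α, α = MulAut.conj t * φ := ⟨_, rfl⟩
  have hα' : α = (MulAut.conj h)⁻¹ * ((MulAut.conj u)⁻¹ * φ) := by
    rw [hα, ht, map_mul, map_inv, map_inv, mul_assoc]
  have hαψ : α * ψ = ψ * α := by
    rw [hα', mul_assoc, hφ'ψ, ← mul_assoc, hhψ, mul_assoc]
  have hαH : ∀ g ∈ b.complement i, α g ∈ b.complement i := fun g hg =>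
    hψ.mem_complement (by
      have := DFunLike.congr_fun hαψ g
      rw [MulAut.mul_apply, MulAut.mul_apply, hψ.apply_eq_of_mem hg] at this
      exact this.symm)
  have hαz : α (b i) = b i ∨ α (b i) = (b i)⁻¹ := by
    rw [hα', MulAut.mul_apply]
    rcases hhz with h1 | h1
    · left; rw [h1, ← map_inv, MulAut.conj_apply]; group
    · right; rw [h1, ← map_inv, MulAut.conj_apply]; group
  have hαα : α * α = 1 := by
    have h1 : α * α = MulAut.conj (t * φ t) := by
      rw [hα, mul_assoc (MulAut.conj t), ← mul_assoc φ, mulAut_mul_conj, mul_assoc _ φ,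
        hφ.mul_self, mul_one, map_mul]
    have h2 : ψ (t * φ t) = t * φ t := by
      apply b.conj_injective
      have h3 : ψ * MulAut.conj (t * φ t) = MulAut.conj (t * φ t) * ψ := by
        rw [← h1]
        exact ((show Commute α ψ from hαψ).mul_left hαψ).eq.symm
      rw [mulAut_mul_conj] at h3
      exact mul_right_cancel h3
    have h4 : (α * α) (b i) = b i := by
      rcases hαz with h | h <;> simp [h]
    have h5 : t * φ t = 1 := by
      refine hψ.eq_one_of_conj_eq ?_
      rw [h2]
      rw [h1, MulAut.conj_apply, mul_inv_eq_iff_eq_mul] at h4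
      rw [mul_inv_eq_iff_eq_mul, h4]
    rw [h1, h5, map_one]
  have hαφψ : MulAut.conj t * (φ * ψ) = α * ψ := by rw [hα, mul_assoc]
  obtain ⟨c, hc | ⟨φ', hc, hαc⟩⟩ := hα ▸ hφ.isFlip_or_twisted (hα ▸ hαα)
  · rcases hαz with hz | hz
    · obtain ⟨J, d, hd⟩ := hc.exists_isDoubleFlip_of_fixes hψ hz hαH
      exact ⟨J, d, t, hαφψ ▸ hd⟩
    · exfalso
      have : α = ψ := by
        ext g
        refine b.eq_of_eqOn_complement (f := α.toMonoidHom) (k := ψ.toMonoidHom) (i := i)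
          (hz.trans hψ.1.symm) (fun g hg => ?_) g
        exact (hc.apply_eq_of_inverts hz hαH hg).trans (hψ.apply_eq_of_mem hg).symm
      refine hne t⁻¹ ?_
      rw [map_inv]
      exact eq_inv_of_mul_eq_one_right (by rw [hαφψ, this, hψ.mul_self])
  · exfalso
    rw [hαc] at hαz hαH
    rcases hαz with hz | hz
    · exact b.basis_ne_one i (hc.eq_one_of_conj_eq hz)
    · exact hc.conj_mul_not_inverts hz hαH

end FreeGroupBasis

namespace FreeGroupBasis

section

variable {ι κ G : Type*} [Group G] {b : FreeGroupBasis ι G} {c : FreeGroupBasis κ G}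
  {i j : ι} {k l : κ} {φ ψ : MulAut G}

theorem mulAut_ext (b : FreeGroupBasis ι G) (h : ∀ i, φ (b i) = ψ (b i)) : φ = ψ := by
  have : φ.toMonoidHom = ψ.toMonoidHom := b.ext_hom _ _ h
  ext g
  exact DFunLike.congr_fun this g

/-- The automorphism taking one basis of a free group to another one. -/
theorem exists_mulAut_apply (b : FreeGroupBasis ι G) (c : FreeGroupBasis κ G) (e : ι ≃ κ) :
    ∃ α : MulAut G, ∀ i, α (b i) = c (e i) :=
  ⟨(b.reindex e).repr.trans c.repr.symm, fun i => by
    have h : b i = b.reindex e (e i) := by simp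
    change c.repr.symm ((b.reindex e).repr (b i)) = c.repr.symm (FreeGroup.of (e i))
    rw [h, repr_apply_coe]⟩

theorem nonempty_equiv (b : FreeGroupBasis ι G) (c : FreeGroupBasis κ G) : Nonempty (ι ≃ κ) :=
  ⟨Equiv.ofFreeGroupEquiv (b.repr.symm.trans c.repr)⟩

theorem IsDoubleFlip.isConj (hφ : b.IsDoubleFlip i j φ) (hψ : c.IsDoubleFlip k l ψ)
    (hij : i ≠ j) (hkl : k ≠ l) : IsConj φ ψ := by
  classical
  obtain ⟨e₀⟩ := b.nonempty_equiv c
  let e₁ := e₀.trans (Equiv.swap (e₀ i) k)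
  let e := e₁.trans (Equiv.swap (e₁ j) l)
  have he₁ : e₁ i = k := by simp [e₁]
  have hj : e j = l := by simp [e]
  have hi : e i = k := by
    have h1 : k ≠ e₁ j := fun h => hij (e₁.injective (he₁.trans h))
    simp only [e, Equiv.trans_apply, he₁]
    exact Equiv.swap_apply_of_ne_of_ne h1 hkl
  obtain ⟨α, hα⟩ := b.exists_mulAut_apply c e
  refine isConj_iff.2 ⟨α, ?_⟩
  rw [mul_inv_eq_iff_eq_mul]
  refine b.mulAut_ext fun m => ?_
  rw [MulAut.mul_apply, MulAut.mul_apply, hα]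
  by_cases hmi : m = i
  · rw [hmi, hi, hφ.1, hψ.1, map_inv, hα, hi]
  by_cases hmj : m = j
  · rw [hmj, hj, hφ.2.1, hψ.2.1, map_inv, hα, hj]
  rw [hφ.2.2 m hmi hmj, hα, hψ.2.2]
  · exact fun h => hmi (e.injective (h.trans hi.symm))
  · exact fun h => hmj (e.injective (h.trans hj.symm))

/-- Every flip is conjugate to a flip of the same basis at any other index. -/
theorem IsFlip.exists_isConj (hφ : b.IsFlip i φ) (j : ι) : ∃ ψ, IsConj φ ψ ∧ b.IsFlip j ψ := by
  classical
  obtain ⟨α, hα⟩ := b.exists_mulAut_apply b (Equiv.swap i j)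
  have hα' : ∀ k, α⁻¹ (b k) = b (Equiv.swap i j k) := fun k => by
    apply α.injective
    rw [MulAut.apply_inv_self, hα, Equiv.swap_apply_self]
  refine ⟨α * φ * α⁻¹, isConj_iff.2 ⟨α, rfl⟩, ?_, fun k hk => ?_⟩
  · simp only [MulAut.mul_apply]
    rw [hα', Equiv.swap_apply_right, hφ.1, map_inv, hα, Equiv.swap_apply_left]
  · simp only [MulAut.mul_apply]
    rw [hα', hφ.2, hα, Equiv.swap_apply_self]
    exact fun h => hk (by rw [← Equiv.swap_apply_self i j k, h, Equiv.swap_apply_left])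

theorem IsFlip.mul (hφ : b.IsFlip i φ) (hψ : b.IsFlip j ψ) (hij : i ≠ j) :
    b.IsDoubleFlip i j (φ * ψ) := by
  refine ⟨?_, ?_, fun k hki hkj => ?_⟩
  · rw [MulAut.mul_apply, hψ.2 i hij, hφ.1]
  · rw [MulAut.mul_apply, hψ.1, map_inv, hφ.2 j hij.symm]
  · rw [MulAut.mul_apply, hψ.2 k hkj, hφ.2 k hki]

theorem IsDoubleFlip.mul_self (hφ : b.IsDoubleFlip i j φ) : φ * φ = 1 := by
  refine b.mulAut_ext fun k => ?_
  rw [MulAut.mul_apply, MulAut.one_apply]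
  by_cases hki : k = i
  · rw [hki, hφ.1, map_inv, hφ.1, inv_inv]
  by_cases hkj : k = j
  · rw [hkj, hφ.2.1, map_inv, hφ.2.1, inv_inv]
  rw [hφ.2.2 k hki hkj, hφ.2.2 k hki hkj]

/-- The exponent sum of the basis element `b i`. -/
def exponentSum [DecidableEq ι] (b : FreeGroupBasis ι G) (i : ι) : G →* Multiplicative ℤ :=
  b.lift fun j => if j = i then Multiplicative.ofAdd 1 else 1

theorem exponentSum_self [DecidableEq ι] (b : FreeGroupBasis ι G) (i : ι) :
    b.exponentSum i (b i) = Multiplicative.ofAdd 1 := by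
  rw [exponentSum, lift_basis, if_pos rfl]

theorem exponentSum_of_ne [DecidableEq ι] (b : FreeGroupBasis ι G) {i j : ι} (h : j ≠ i) :
    b.exponentSum i (b j) = 1 := by
  rw [exponentSum, lift_basis, if_neg h]

theorem eq_one_of_inv_eq_self {z : Multiplicative ℤ} (h : z⁻¹ = z) : z = 1 := by
  have h' : -z.toAdd = z.toAdd := congrArg Multiplicative.toAdd h
  have : z.toAdd = 0 := by omega
  exact this

theorem ne_conj_of_inverts (b : FreeGroupBasis ι G) (h : φ (b i) = (b i)⁻¹) (v : G) :
    φ ≠ MulAut.conj v := by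
  classical
  rintro rfl
  have h1 := congrArg (b.exponentSum i) h
  rw [MulAut.conj_apply, map_mul, map_mul, map_inv, map_inv, mul_inv_cancel_comm] at h1
  have h2 := eq_one_of_inv_eq_self h1.symm
  rw [exponentSum_self] at h2
  exact absurd (congrArg Multiplicative.toAdd h2) (by simp)

/-- A flip is not a square modulo inner automorphisms. -/
theorem IsFlip.ne_conj_mul_mul_self (hφ : b.IsFlip i φ) (γ : MulAut G) (v : G) :
    φ ≠ MulAut.conj v * (γ * γ) := by
  classical
  intro h
  let χ := b.exponentSum i
  have hχγ : ∀ g, χ (φ g) = χ (γ (γ g)) := fun g => by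
    rw [h, MulAut.mul_apply, MulAut.conj_apply, map_mul, map_mul, map_inv, mul_inv_cancel_comm]
    rfl
  have hχφ : ∀ g, χ (φ g) = (χ g)⁻¹ := by
    have : χ.comp φ.toMonoidHom = χ⁻¹ := by
      refine b.ext_hom _ _ fun j => ?_
      change χ (φ (b j)) = (χ (b j))⁻¹
      by_cases hj : j = i
      · rw [hj, hφ.1, map_inv]
      · rw [hφ.2 j hj, b.exponentSum_of_ne hj, inv_one]
    exact fun g => DFunLike.congr_fun this g
  have hχγφ : ∀ g, χ (γ (φ g)) = (χ (γ g))⁻¹ := by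
    intro g
    rw [h, MulAut.mul_apply, MulAut.conj_apply, map_mul, map_mul, map_mul, map_mul, map_inv,
      map_inv, mul_inv_cancel_comm, MulAut.mul_apply, ← hχγ, hχφ]
  obtain ⟨n, hn⟩ : ∃ n : ℤ, χ (γ (b i)) = Multiplicative.ofAdd n := ⟨_, rfl⟩
  have hpow : ∀ g, χ (γ g) = χ g ^ n := by
    have : χ.comp γ.toMonoidHom = χ ^ n := by
      refine b.ext_hom _ _ fun j => ?_
      change χ (γ (b j)) = χ (b j) ^ n
      by_cases hj : j = i
      · rw [hj, hn, b.exponentSum_self, ← ofAdd_zsmul]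
        simp
      · rw [b.exponentSum_of_ne hj, one_zpow]
        refine eq_one_of_inv_eq_self ?_
        rw [← hχγφ, hφ.2 j hj]
    exact fun g => DFunLike.congr_fun this g
  have h1 := (hχφ (b i)).symm.trans (hχγ (b i))
  rw [hpow, hn, b.exponentSum_self, ← ofAdd_zsmul, ← ofAdd_neg] at h1
  have h2 : (-1 : ℤ) = n • n := Multiplicative.ofAdd.injective h1
  rw [smul_eq_mul] at h2
  nlinarith [mul_self_nonneg n]

end

end FreeGroupBasis

/-- The basis indexed by a set which is a basis. -/
theorem FreeGroup.IsBasis.exists_freeGroupBasis {X : Type*} {S : Set (FreeGroup X)}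
    (hS : FreeGroup.IsBasis S) : ∃ b : FreeGroupBasis S (FreeGroup X), ∀ s, b s = s :=
  ⟨.ofRepr (MulEquiv.ofBijective _ hS).symm, fun _ => FreeGroup.lift_apply_of⟩

theorem IsExtremalInvolution.exists_isFlip {X : Type*} {φ : MulAut (FreeGroup X)}
    (hφ : IsExtremalInvolution φ) :
    ∃ (S : Set (FreeGroup X)) (b : FreeGroupBasis S (FreeGroup X)) (i : S), b.IsFlip i φ := by
  obtain ⟨-, S, x, hS, hx, hφx, hfix⟩ := hφ
  obtain ⟨b, hb⟩ := hS.exists_freeGroupBasis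
  refine ⟨S, b, ⟨x, hx⟩, ?_, fun j hj => ?_⟩
  · rw [hb, hφx]
  · rw [hb, hfix j j.2 fun h => hj (Subtype.ext h)]

theorem toOut_surjective {G : Type*} [Group G] :
    Function.Surjective (toOut : MulAut G → OutAut G) :=
  QuotientGroup.mk'_surjective _

theorem toOut_eq_one_iff {G : Type*} [Group G] {φ : MulAut G} :
    toOut φ = 1 ↔ ∃ v, φ = MulAut.conj v :=
  (QuotientGroup.eq_one_iff φ).trans (exists_congr fun _ => eq_comm)

theorem toOut_conj {G : Type*} [Group G] (v : G) : toOut (MulAut.conj v) = 1 :=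
  toOut_eq_one_iff.2 ⟨v, rfl⟩

theorem exists_mulAut_of_isConj_toOut {G : Type*} [Group G] {φ : MulAut G} {k : OutAut G}
    (h : IsConj (toOut φ) k) : ∃ α : MulAut G, toOut (α * φ * α⁻¹) = k := by
  obtain ⟨a, rfl⟩ := isConj_iff.1 h
  obtain ⟨α, rfl⟩ := toOut_surjective a
  exact ⟨α, by rw [map_mul, map_mul, map_inv]⟩

/-- Let `φ ∈ Aut F` be an extremal involution and let `K` be the conjugacy class of `φ̂`
in `Out F`. Then `K·K` contains exactly one conjugacy class of involutions of `Out F`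
and no element of `K` is a square in `Out F`; that is, the class of extremal involutions
satisfies condition (★). -/
theorem extremal_class_satisfies_star (X : Type*) [Infinite X]
    (φ : MulAut (FreeGroup X)) (hφ : IsExtremalInvolution φ)
    (K : Set (OutAut (FreeGroup X)))
    (hK : K = {g | IsConj (toOut φ) g}) :
    StarCondition K := by

  subst hK
  obtain ⟨S, b, i, hb⟩ := hφ.exists_isFlip
  have : Infinite S := by
    obtain ⟨e⟩ := b.nonempty_equiv (FreeGroupBasis.ofFreeGroup X)
    exact Infinite.of_injective e.symm e.symm.injective
  obtain ⟨j, hj⟩ := exists_ne i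
  obtain ⟨ε, hφε, hε⟩ := hb.exists_isConj j
  have hdouble := hb.mul hε hj.symm
  refine ⟨⟨toOut φ * toOut ε, Set.mul_mem_mul (IsConj.refl _) (toOut.map_isConj hφε), ?_, ?_⟩, ?_⟩
  · rw [← map_mul]
    refine ⟨fun h => ?_, ?_⟩
    · obtain ⟨v, hv⟩ := toOut_eq_one_iff.1 h
      exact b.ne_conj_of_inverts hdouble.1 v hv
    · rw [sq, ← map_mul, hdouble.mul_self, map_one]
  · rintro _ ⟨k₁, hk₁, k₂, hk₂, rfl⟩ ⟨hne, hsq⟩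
    obtain ⟨α₁, rfl⟩ := exists_mulAut_of_isConj_toOut hk₁
    obtain ⟨α₂, rfl⟩ := exists_mulAut_of_isConj_toOut hk₂
    simp only [← map_mul] at hne hsq ⊢
    rw [sq, ← map_mul] at hsq
    obtain ⟨w, hw⟩ := toOut_eq_one_iff.1 hsq
    obtain ⟨J, c, t, hc⟩ := (hb.conj α₁).exists_isDoubleFlip (hb.conj α₂) hw
      fun v hv => hne (toOut_eq_one_iff.2 ⟨v, hv⟩)
    have := toOut.map_isConj (hdouble.isConj hc hj.symm (by simp))
    rwa [map_mul toOut (MulAut.conj t), toOut_conj, one_mul] at this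
  · rintro k hk ⟨g, rfl⟩
    obtain ⟨α, hα⟩ := exists_mulAut_of_isConj_toOut hk
    obtain ⟨γ, rfl⟩ := toOut_surjective g
    rw [sq, ← map_mul, ← mul_inv_eq_one, ← map_inv, ← map_mul] at hα
    obtain ⟨v, hv⟩ := toOut_eq_one_iff.1 hα
    exact (hb.conj α).ne_conj_mul_mul_self γ v (mul_inv_eq_iff_eq_mul.1 hv)
end
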